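/- Let b = (b^{ij}) be a matrix of BMO(ℝⁿ) functions that is skew-symmetric (b^{ij} = −b^{ji}). Then there is a constant C depending only on the dimension n such that |∫_{ℝⁿ} ⟨∇f(x), b(x)·∇g(x)⟩ dx| ≤ C ‖b‖_BMO ‖∇f‖₂ ‖∇g‖₂ for all f, g ∈ H¹(ℝⁿ), where the integral is interpreted via the 𝓗¹–BMO duality pairing. -/

import Mathlib

open MeasureTheory Metric

/-- `M` is a bound for the BMO seminorm of `f`. -/
def IsBMOBound {n : ℕ} (f : EuclideanSpace ℝ (Fin n) → ℝ) (M : ℝ) : Prop :=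
  ∀ (x : EuclideanSpace ℝ (Fin n)) (r : ℝ), 0 < r →
    ⨍ y in ball x r, |f y - ⨍ z in ball x r, f z| ≤ M

section Aux
open scoped NNReal Topology ENNReal

section P1
variable {E : Type*} [NormedAddCommGroup E] [NormedSpace ℝ E] [FiniteDimensional ℝ E]
  [MeasurableSpace E] [BorelSpace E] (μ : Measure E) [μ.IsAddHaarMeasure]

/-- Jacobian of two functions in two directions. -/
noncomputable def jac (v w : E) (φ ψ : E → ℝ) (x : E) : ℝ :=
  lineDeriv ℝ φ x v * lineDeriv ℝ ψ x w - lineDeriv ℝ φ x w * lineDeriv ℝ ψ x v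

theorem integrable_lineDeriv_of_compact {C : ℝ≥0} {φ : E → ℝ} (hφ : LipschitzWith C φ)
    (hc : HasCompactSupport φ) (v : E) : Integrable (fun x => lineDeriv ℝ φ x v) μ := by
  have hm : AEStronglyMeasurable (fun x => lineDeriv ℝ φ x v) μ :=
    (measurable_lineDeriv hφ.continuous).aestronglyMeasurable
  have h1 : IntegrableOn (fun x => lineDeriv ℝ φ x v) (tsupport φ) μ :=
    (hφ.locallyIntegrable_lineDeriv v).integrableOn_isCompact hc
  refine (integrableOn_iff_integrable_of_support_subset ?_).1 h1
  intro x hx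
  by_contra hn
  apply hx
  have : φ =ᶠ[𝓝 x] fun _ => 0 := notMem_tsupport_iff_eventuallyEq.1 hn
  show lineDeriv ℝ φ x v = 0
  rw [this.lineDeriv_eq]
  simp [lineDeriv]

theorem integral_lineDeriv_mul_swap {C D : ℝ≥0} {φ ψ : E → ℝ} (hφ : LipschitzWith C φ)
    (hφc : HasCompactSupport φ) (hψ : LipschitzWith D ψ) (hψc : HasCompactSupport ψ) (v w : E) :
    ∫ x, lineDeriv ℝ ψ x w * lineDeriv ℝ φ x v ∂μ
      = ∫ x, lineDeriv ℝ φ x w * lineDeriv ℝ ψ x v ∂μ := by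
  have A := hψ.integral_inv_smul_sub_mul_tendsto_integral_lineDeriv_mul
    (integrable_lineDeriv_of_compact μ hφ hφc v) w
  have B := hφ.integral_inv_smul_sub_mul_tendsto_integral_lineDeriv_mul
    (integrable_lineDeriv_of_compact μ hψ hψc (-v)) (-w)
  have key : ∀ t : ℝ, ∫ x, (t⁻¹ • (ψ (x + t • w) - ψ x)) * lineDeriv ℝ φ x v ∂μ
      = ∫ x, (t⁻¹ • (φ (x + t • (-w)) - φ x)) * lineDeriv ℝ ψ x (-v) ∂μ := by
    intro t
    simp only [smul_eq_mul, mul_assoc, integral_const_mul]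
    congr 1
    have hi1 := integrable_lineDeriv_of_compact μ hφ hφc v
    have hi2 := integrable_lineDeriv_of_compact μ hψ hψc (-v)
    have hψt : LipschitzWith D (fun x => ψ (x + t • w)) := by
      refine LipschitzWith.of_dist_le_mul fun x y => ?_
      simpa using hψ.dist_le_mul (x + t • w) (y + t • w)
    have hψtc : HasCompactSupport (fun x => ψ (x + t • w)) :=
      hψc.comp_homeomorph (Homeomorph.addRight (t • w))
    have e1 : ∫ x, ψ (x + t • w) * lineDeriv ℝ φ x v ∂μ
        = ∫ x, φ (x + t • (-w)) * lineDeriv ℝ ψ x (-v) ∂μ := by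
      have h := hφ.integral_lineDeriv_mul_eq (μ := μ) hψt hψtc v
      calc _ = ∫ x, lineDeriv ℝ φ x v * ψ (x + t • w) ∂μ := by simp_rw [mul_comm]
        _ = ∫ x, lineDeriv ℝ (fun x => ψ (x + t • w)) x (-v) * φ x ∂μ := h
        _ = ∫ x, lineDeriv ℝ ψ (x + t • w) (-v) * φ x ∂μ := by
          congr 1; ext x; congr 1
          simp only [lineDeriv]; congr 1; ext s; congr 1; abel
        _ = _ := by
          rw [← integral_add_right_eq_self _ (t • (-w))]
          congr 1; ext x; rw [mul_comm]; simp
    have e2 : ∫ x, ψ x * lineDeriv ℝ φ x v ∂μ = ∫ x, φ x * lineDeriv ℝ ψ x (-v) ∂μ := by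
      have h := hφ.integral_lineDeriv_mul_eq (μ := μ) hψ hψc v
      simp_rw [mul_comm] at h ⊢; exact h
    simp_rw [sub_mul]
    have bd : ∀ {χ : E → ℝ}, Continuous χ → HasCompactSupport χ → ∀ {h : E → ℝ}, Integrable h μ →
        Integrable (fun x => χ x * h x) μ := by
      intro χ h1 h2 h hh
      obtain ⟨K, hK⟩ := h1.bounded_above_of_compact_support h2
      exact hh.bdd_mul h1.aestronglyMeasurable (Filter.Eventually.of_forall hK)
    rw [integral_sub, integral_sub, e1, e2]
    · exact bd (hφ.continuous.comp (continuous_add_const _))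
        (hφc.comp_homeomorph (Homeomorph.addRight (t • (-w)))) hi2
    · exact bd hφ.continuous hφc hi2
    · exact bd hψt.continuous hψtc hi1
    · exact bd hψ.continuous hψc hi1
  simp only [key] at A
  rw [tendsto_nhds_unique A B]
  simp [lineDeriv_neg]

theorem integrable_bdd_mul_jac {C D : ℝ≥0} {φ ψ : E → ℝ} (hφ : LipschitzWith C φ)
    (hψ : LipschitzWith D ψ) (hψc : HasCompactSupport ψ) (v w : E) {b : E → ℝ} {N : ℝ}
    (hb : AEStronglyMeasurable b μ) (hN : ∀ x, |b x| ≤ N) :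
    Integrable (fun x => b x * jac v w φ ψ x) μ := by
  refine Integrable.bdd_mul (c := N) ?_ hb (Filter.Eventually.of_forall hN)
  unfold jac
  refine Integrable.sub ?_ ?_
  · refine (integrable_lineDeriv_of_compact μ hψ hψc w).bdd_mul (c := C * ‖v‖)
      (measurable_lineDeriv hφ.continuous).aestronglyMeasurable ?_
    exact Filter.Eventually.of_forall fun x => norm_lineDeriv_le_of_lipschitz ℝ hφ
  · refine (integrable_lineDeriv_of_compact μ hψ hψc v).bdd_mul (c := C * ‖w‖)
      (measurable_lineDeriv hφ.continuous).aestronglyMeasurable ?_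
    exact Filter.Eventually.of_forall fun x => norm_lineDeriv_le_of_lipschitz ℝ hφ

theorem integral_jac_eq_zero {C D : ℝ≥0} {φ ψ : E → ℝ} (hφ : LipschitzWith C φ)
    (hφc : HasCompactSupport φ) (hψ : LipschitzWith D ψ) (hψc : HasCompactSupport ψ) (v w : E) :
    ∫ x, jac v w φ ψ x ∂μ = 0 := by
  have bd : ∀ v w, Integrable (fun x => lineDeriv ℝ φ x v * lineDeriv ℝ ψ x w) μ := by
    intro v w
    refine (integrable_lineDeriv_of_compact μ hψ hψc w).bdd_mul (c := C * ‖v‖)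
      (measurable_lineDeriv hφ.continuous).aestronglyMeasurable ?_
    exact Filter.Eventually.of_forall fun x => norm_lineDeriv_le_of_lipschitz ℝ hφ
  unfold jac
  rw [integral_sub (bd v w) (bd w v), ← integral_lineDeriv_mul_swap μ hφ hφc hψ hψc v w, sub_eq_zero]
  simp_rw [mul_comm]

theorem ae_lineDeriv_eq_zero {C : ℝ≥0} {φ : E → ℝ} (hφ : LipschitzWith C φ) (v : E) :
    ∀ᵐ x ∂μ, φ x = 0 → lineDeriv ℝ φ x v = 0 := by
  have h1 : LipschitzWith C (fun x => |φ x|) := by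
    have := (lipschitzWith_one_norm (E := ℝ)).comp hφ
    simpa [Function.comp_def] using this
  filter_upwards [h1.ae_lineDifferentiableAt (μ := μ) v] with x hx h0
  have h2 := hx.hasLineDerivAt
  have hmin : lineDeriv ℝ (fun x => |φ x|) x v = 0 := by
    have : IsLocalMin (fun t : ℝ => |φ (x + t • v)|) 0 := by
      refine Filter.Eventually.of_forall fun t => ?_
      simp [h0]
    exact this.deriv_eq_zero
  rw [hmin] at h2
  have h3 : HasDerivAt (fun t : ℝ => |φ (x + t • v)|) 0 0 := h2
  have h4 : HasDerivAt (fun t : ℝ => φ (x + t • v)) 0 0 := by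
    rw [hasDerivAt_iff_isLittleO] at h3 ⊢
    simp only [zero_smul, add_zero, h0, abs_zero, sub_zero, smul_zero] at h3 ⊢
    exact h3.of_norm_left
  exact h4.deriv

end P1

section P2
set_option linter.unusedSectionVars false
open Module
variable {E : Type*} [NormedAddCommGroup E] [NormedSpace ℝ E] [FiniteDimensional ℝ E]
  [MeasurableSpace E] [BorelSpace E] (μ : Measure E) [μ.IsAddHaarMeasure]

theorem real_ball_scale (x y : E) {c ρ : ℝ} (hc : 0 < c) :
    μ.real (ball x (c * ρ)) = c ^ finrank ℝ E * μ.real (ball y ρ) := by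
  rw [measureReal_def, measureReal_def, Measure.addHaar_ball_mul_of_pos μ x hc, ENNReal.toReal_mul,
    ENNReal.toReal_ofReal (by positivity), Measure.addHaar_ball_center μ y]

theorem real_ball_pos (x : E) {ρ : ℝ} (h : 0 < ρ) : 0 < μ.real (ball x ρ) :=
  ENNReal.toReal_pos (measure_ball_pos μ x h).ne' measure_ball_lt_top.ne

/-- Tent weight of radius `r x` centred at `x`. -/
noncomputable def wgt (r : E → ℝ) (x y : E) : ℝ := max (r x - dist x y) 0

/-- Variable scale average. -/
noncomputable def bt (r : E → ℝ) (b : E → ℝ) (x : E) : ℝ :=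
  (∫ y, b y * wgt r x y ∂μ) / ∫ y, wgt r x y ∂μ

/-- Mean oscillation bound with some constant on each ball. -/
def Osc (b : E → ℝ) (M : ℝ) : Prop :=
  ∀ (x : E) (ρ : ℝ), 0 < ρ → ∃ c : ℝ, ∫ y in ball x ρ, |b y - c| ∂μ ≤ M * μ.real (ball x ρ)

theorem wgt_nonneg (r : E → ℝ) (x y : E) : 0 ≤ wgt r x y := le_max_right _ _

theorem wgt_cont (r : E → ℝ) (x : E) : Continuous (wgt r x) := by unfold wgt; fun_prop

theorem wgt_lip {r : E → ℝ} (hr : LipschitzWith (1/4) r) (x x' y : E) :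
    |wgt r x y - wgt r x' y| ≤ 2 * dist x x' := by
  unfold wgt
  have h1 := hr.dist_le_mul x x'
  rw [Real.dist_eq] at h1
  have h1' : |r x - r x'| ≤ 1/4 * dist x x' := by simpa using h1
  have h2 := abs_dist_sub_le x x' y
  refine (abs_max_sub_max_le_abs _ _ _).trans ?_
  rw [abs_le] at *
  have := dist_nonneg (x := x) (y := x')
  constructor <;> linarith

theorem rad_close {r : E → ℝ} (hr : LipschitzWith (1/4) r) {x x0 : E}
    (hx : x ∈ ball x0 (r x0 / 2)) : 7/8 * r x0 ≤ r x ∧ r x ≤ 9/8 * r x0 := by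
  have h1 := hr.dist_le_mul x x0
  rw [Real.dist_eq] at h1
  have h1' : |r x - r x0| ≤ 1/4 * dist x x0 := by simpa using h1
  rw [mem_ball] at hx
  rw [abs_le] at h1'
  constructor <;> linarith

theorem wgt_supp {r : E → ℝ} (hr : LipschitzWith (1/4) r) {x x0 : E}
    (hx : x ∈ ball x0 (r x0 / 2)) {y : E} (hy : y ∉ ball x0 (2 * r x0)) : wgt r x y = 0 := by
  have h := rad_close hr hx
  unfold wgt
  apply max_eq_right
  rw [mem_ball] at hx hy
  have := dist_triangle y x x0
  rw [dist_comm y x] at this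
  have := dist_nonneg (x := x) (y := x0)
  linarith

theorem wgt_le {r : E → ℝ} (hr : LipschitzWith (1/4) r) {x x0 : E}
    (hx : x ∈ ball x0 (r x0 / 2)) (y : E) : wgt r x y ≤ 2 * r x0 := by
  have h := rad_close hr hx
  have : 0 < r x0 / 2 := pos_of_mem_ball hx
  have := dist_nonneg (x := x) (y := y)
  unfold wgt
  apply max_le <;> linarith

theorem bt_facts {r : E → ℝ} (hr : LipschitzWith (1/4) r) {b : E → ℝ}
    (hbl : LocallyIntegrable b μ) {M : ℝ} (hM : Osc μ b M) {x0 : E} (h0 : 0 < r x0) :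
    ∃ c : ℝ, ∫ y in ball x0 (2 * r x0), |b y - c| ∂μ ≤ M * μ.real (ball x0 (2 * r x0)) ∧
      (∀ x ∈ ball x0 (r x0 / 2), |bt μ r b x - c| ≤ 4 * 8 ^ finrank ℝ E * M) ∧
      ∀ x ∈ ball x0 (r x0 / 2), ∀ x' ∈ ball x0 (r x0 / 2),
        |bt μ r b x - bt μ r b x'| ≤
          (2 * 8 ^ finrank ℝ E * (2 + 8 * 8 ^ finrank ℝ E)) * M * dist x x' / r x0 := by
  obtain ⟨c, hc⟩ := hM x0 (2 * r x0) (by positivity)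
  refine ⟨c, hc, ?_⟩
  set B := ball x0 (2 * r x0) with hB
  set V := μ.real B with hV
  have hVpos : 0 < V := real_ball_pos μ x0 (by positivity)
  have hbB : IntegrableOn (fun y => b y - c) B μ :=
    ((hbl.integrableOn_isCompact (isCompact_closedBall x0 (2 * r x0))).mono_set
      ball_subset_closedBall).sub (integrableOn_const (by exact measure_ball_lt_top.ne))
  have hbB1 : IntegrableOn b B μ :=
    ((hbl.integrableOn_isCompact (isCompact_closedBall x0 (2 * r x0))).mono_set
      ball_subset_closedBall)
  have h1B : IntegrableOn (fun _ : E => (1:ℝ)) B μ :=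
    integrableOn_const (by exact measure_ball_lt_top.ne)
  set D := finrank ℝ E
  have hM0 : 0 ≤ M := by
    have : 0 ≤ ∫ y in B, |b y - c| ∂μ := integral_nonneg fun _ => abs_nonneg _
    by_contra hneg
    push Not at hneg
    nlinarith
  -- generic weighted integrals
  have gint : ∀ {g : E → ℝ}, IntegrableOn g B μ → ∀ x ∈ ball x0 (r x0 / 2),
      IntegrableOn (fun y => g y * wgt r x y) B μ := by
    intro g hg x hx
    refine Integrable.mul_bdd (c := 2 * r x0) hg (wgt_cont r x).aestronglyMeasurable ?_
    refine Filter.Eventually.of_forall fun y => ?_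
    rw [Real.norm_eq_abs, abs_of_nonneg (wgt_nonneg _ _ _)]
    exact wgt_le hr hx y
  have gres : ∀ (g : E → ℝ), ∀ x ∈ ball x0 (r x0 / 2),
      ∫ y, g y * wgt r x y ∂μ = ∫ y in B, g y * wgt r x y ∂μ := by
    intro g x hx
    refine (setIntegral_eq_integral_of_forall_compl_eq_zero fun y hy => ?_).symm
    rw [wgt_supp hr hx hy, mul_zero]
  have gbd : ∀ {g : E → ℝ}, IntegrableOn g B μ → ∀ x ∈ ball x0 (r x0 / 2),
      |∫ y in B, g y * wgt r x y ∂μ| ≤ 2 * r x0 * ∫ y in B, |g y| ∂μ := by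
    intro g hg x hx
    rw [← integral_const_mul]
    refine norm_integral_le_of_norm_le (f := fun y => g y * wgt r x y)
      (g := fun y => 2 * r x0 * |g y|) (hg.abs.const_mul _) ?_
    refine Filter.Eventually.of_forall fun y => ?_
    rw [norm_mul, Real.norm_eq_abs, Real.norm_eq_abs, abs_of_nonneg (wgt_nonneg _ _ _), mul_comm]
    exact mul_le_mul_of_nonneg_right (wgt_le hr hx y) (abs_nonneg _)
  have gdiff : ∀ {g : E → ℝ}, IntegrableOn g B μ → ∀ x ∈ ball x0 (r x0 / 2),
      ∀ x' ∈ ball x0 (r x0 / 2),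
      |∫ y in B, g y * wgt r x y ∂μ - ∫ y in B, g y * wgt r x' y ∂μ|
        ≤ 2 * dist x x' * ∫ y in B, |g y| ∂μ := by
    intro g hg x hx x' hx'
    rw [← integral_const_mul, ← integral_sub (gint hg x hx) (gint hg x' hx')]
    refine norm_integral_le_of_norm_le (f := fun y => g y * wgt r x y - g y * wgt r x' y)
      (g := fun y => 2 * dist x x' * |g y|) (hg.abs.const_mul _) ?_
    refine Filter.Eventually.of_forall fun y => ?_
    rw [← mul_sub, norm_mul, Real.norm_eq_abs, Real.norm_eq_abs, mul_comm]
    exact mul_le_mul_of_nonneg_right (wgt_lip hr x x' y) (abs_nonneg _)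
  have hone : ∀ x, ∫ y, wgt r x y ∂μ = ∫ y, 1 * wgt r x y ∂μ := by simp
  have habs1 : ∫ _ in B, |(1:ℝ)| ∂μ = V := by simp [hV, measureReal_def]
  -- lower bound for W
  have hW : ∀ x ∈ ball x0 (r x0 / 2), r x0 * V / (2 * 8 ^ D) ≤ ∫ y, wgt r x y ∂μ := by
    intro x hx
    have hrx := rad_close hr hx
    have hIntg : Integrable (fun y => wgt r x y) μ := by
      have h := gint h1B x hx
      refine (integrableOn_iff_integrable_of_support_subset (s := B) ?_).1 (by simpa using h)
      intro y hy
      by_contra hn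
      exact hy (wgt_supp hr hx hn)
    have e1 : ∫ _ in ball x (r x0 / 4), (r x0 / 2) ∂μ = r x0 * V / (2 * 8 ^ D) := by
      have := real_ball_scale μ x x0 (c := 1/8) (ρ := 2 * r x0) (by norm_num)
      rw [show (1/8 : ℝ) * (2 * r x0) = r x0 / 4 by ring] at this
      rw [setIntegral_const, this, smul_eq_mul, one_div, inv_pow]
      simp only [hV, hB]
      field_simp
      ring
    rw [← e1]
    calc _ ≤ ∫ y in ball x (r x0 / 4), wgt r x y ∂μ := by
            refine setIntegral_mono_on (integrableOn_const (by exact measure_ball_lt_top.ne))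
              hIntg.integrableOn measurableSet_ball ?_
            intro y hy
            rw [mem_ball, dist_comm] at hy
            unfold wgt
            apply le_max_of_le_left
            linarith
      _ ≤ _ := setIntegral_le_integral hIntg
          (Filter.Eventually.of_forall fun y => wgt_nonneg _ _ _)
  have hLpos : 0 < r x0 * V / (2 * 8 ^ D) := by positivity
  have hWpos : ∀ x ∈ ball x0 (r x0 / 2), 0 < ∫ y, wgt r x y ∂μ :=
    fun x hx => hLpos.trans_le (hW x hx)
  set N : E → ℝ := fun x => ∫ y in B, (b y - c) * wgt r x y ∂μ with hN
  set W : E → ℝ := fun x => ∫ y, wgt r x y ∂μ with hWd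
  have hbt : ∀ x ∈ ball x0 (r x0 / 2), bt μ r b x = c + N x / W x := by
    intro x hx
    have hw := hWpos x hx
    unfold bt
    rw [gres b x hx]
    have : N x = ∫ y in B, b y * wgt r x y ∂μ - c * W x := by
      simp only [hN, hWd, sub_mul]
      rw [integral_sub (gint hbB1 x hx), hone, gres (fun _ => 1) x hx, ← integral_const_mul]
      · simp
      · simpa [mul_assoc] using (gint h1B x hx).const_mul c
    have hw2 : W x ≠ 0 := hw.ne'
    rw [this, eq_comm, ← sub_eq_zero]
    change c + (_ - c * W x) / W x - _ / W x = 0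
    field_simp
    ring
  have hNb : ∀ x ∈ ball x0 (r x0 / 2), |N x| ≤ 2 * r x0 * (M * V) := fun x hx =>
    (gbd hbB x hx).trans (mul_le_mul_of_nonneg_left hc (by positivity))
  have hq : ∀ x ∈ ball x0 (r x0 / 2), |N x / W x| ≤ 4 * 8 ^ D * M := by
    intro x hx
    rw [abs_div, abs_of_pos (hWpos x hx), div_le_iff₀ (hWpos x hx)]
    calc |N x| ≤ 2 * r x0 * (M * V) := hNb x hx
      _ = 4 * 8 ^ D * M * (r x0 * V / (2 * 8 ^ D)) := by field_simp; ring
      _ ≤ _ := by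
        have := hW x hx
        gcongr
  refine ⟨fun x hx => ?_, fun x hx x' hx' => ?_⟩
  · rw [hbt x hx, add_sub_cancel_left]; exact hq x hx
  · rw [hbt x hx, hbt x' hx', add_sub_add_left_eq_sub]
    have hw := hWpos x hx
    have hw' := hWpos x' hx'
    have e : N x / W x - N x' / W x' = ((N x - N x') + (N x' / W x') * (W x' - W x)) / W x := by
      have : W x ≠ 0 := hw.ne'
      have : W x' ≠ 0 := hw'.ne'
      field_simp
      ring
    rw [e, abs_div, abs_of_pos hw, div_le_iff₀ hw]
    have d1 : |N x - N x'| ≤ 2 * dist x x' * (M * V) :=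
      (gdiff hbB x hx x' hx').trans (mul_le_mul_of_nonneg_left hc (by positivity))
    have d2 : |W x' - W x| ≤ 2 * dist x x' * V := by
      have := gdiff h1B x hx x' hx'
      rw [habs1] at this
      simp only [hWd]
      rw [hone, hone, gres (fun _ => 1) x hx, gres (fun _ => 1) x' hx', abs_sub_comm]
      exact this
    have d3 := hq x' hx'
    calc |N x - N x' + N x' / W x' * (W x' - W x)|
        ≤ |N x - N x'| + |N x' / W x'| * |W x' - W x| := by
          rw [← abs_mul]; exact abs_add_le _ _
      _ ≤ 2 * dist x x' * (M * V) + 4 * 8 ^ D * M * (2 * dist x x' * V) := by gcongr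
      _ = 2 * 8 ^ D * (2 + 8 * 8 ^ D) * M * dist x x' / r x0 * (r x0 * V / (2 * 8 ^ D)) := by
          field_simp
          ring
      _ ≤ _ := by
          have := hW x hx
          gcongr

theorem bt_zero {r : E → ℝ} {b : E → ℝ} {x : E} (h : r x ≤ 0) : bt μ r b x = 0 := by
  have : ∀ y, wgt r x y = 0 := fun y => by
    unfold wgt
    apply max_eq_right
    have := dist_nonneg (x := x) (y := y)
    linarith
  simp [bt, this]

theorem bt_bdd {r : E → ℝ} {b : E → ℝ} {N : ℝ} (hN : ∀ x, |b x| ≤ N) (x : E) :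
    |bt μ r b x| ≤ N := by
  have hN0 : 0 ≤ N := (abs_nonneg _).trans (hN x)
  unfold bt
  have hIntg : Integrable (fun y => wgt r x y) μ := by
    refine (wgt_cont r x).integrable_of_hasCompactSupport ?_
    refine HasCompactSupport.intro (isCompact_closedBall x (r x)) fun y hy => ?_
    rw [mem_closedBall, dist_comm] at hy
    exact max_eq_right (by linarith)
  rw [abs_div, abs_of_nonneg (integral_nonneg (f := wgt r x) fun y => wgt_nonneg r x y)]
  refine div_le_of_le_mul₀ (integral_nonneg (f := wgt r x) fun y => wgt_nonneg r x y) hN0 ?_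
  rw [← integral_const_mul]
  refine norm_integral_le_of_norm_le (f := fun y => b y * wgt r x y) (hIntg.const_mul N) ?_
  refine Filter.Eventually.of_forall fun y => ?_
  rw [norm_mul, Real.norm_eq_abs, Real.norm_eq_abs, abs_of_nonneg (wgt_nonneg _ _ _)]
  exact mul_le_mul_of_nonneg_right (hN y) (wgt_nonneg _ _ _)

theorem bt_meas {r : E → ℝ} (hr : LipschitzWith (1/4) r) {b : E → ℝ}
    (hbl : LocallyIntegrable b μ) {M : ℝ} (hM : Osc μ b M) : Measurable (bt μ r b) := by
  have ho : IsOpen {x | 0 < r x} := isOpen_lt continuous_const hr.continuous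
  have hc : ContinuousOn (bt μ r b) {x | 0 < r x} := by
    intro x hx
    apply ContinuousAt.continuousWithinAt
    obtain ⟨c, -, -, h3⟩ := bt_facts μ hr hbl hM (show 0 < r x from hx)
    have hx' : 0 < r x := hx
    refine continuousAt_of_locally_lipschitz (r := r x / 2)
      (K := (2 * 8 ^ finrank ℝ E * (2 + 8 * 8 ^ finrank ℝ E)) * M / r x) (by positivity) ?_
    intro y hy
    rw [Real.dist_eq]
    refine (h3 y (mem_ball.2 hy) x (mem_ball_self (by positivity))).trans (le_of_eq (by ring))
  refine measurable_of_restrict_of_restrict_compl ho.measurableSet ?_ ?_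
  · exact (continuousOn_iff_continuous_domRestrict.1 hc).measurable
  · have : Set.domRestrict {x | 0 < r x}ᶜ (bt μ r b) = fun _ => 0 := by
      ext ⟨x, hx⟩
      exact bt_zero μ (not_lt.1 hx)
    rw [this]; exact measurable_const

end P2

section P3
set_option linter.unusedSectionVars false
open Module
variable {E : Type*} [NormedAddCommGroup E] [NormedSpace ℝ E] [FiniteDimensional ℝ E]
  [MeasurableSpace E] [BorelSpace E] (μ : Measure E) [μ.IsAddHaarMeasure]

theorem vitali_measure {ι : Type*} (ν ν' : Measure E) (K : ℝ≥0∞) (t : Set ι) (x : ι → E)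
    (r : ι → ℝ) (R : ℝ) (hR : ∀ a ∈ t, r a ≤ R) (hpos : ∀ a ∈ t, 0 < r a)
    (hK : ∀ a ∈ t, ν (ball (x a) (5 * r a)) ≤ K * ν' (ball (x a) (r a))) :
    ν (⋃ a ∈ t, ball (x a) (r a)) ≤ K * ν' (⋃ a ∈ t, ball (x a) (r a)) := by
  obtain ⟨u, hut, hdis, hcov⟩ :=
    Vitali.exists_disjoint_subfamily_covering_enlargement_ball t x r R hR 5 (by norm_num)
  have hcount : u.Countable := hdis.countable_of_isOpen (fun _ _ => isOpen_ball)
    (fun a ha => nonempty_ball.2 (hpos a (hut ha)))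
  calc ν (⋃ a ∈ t, ball (x a) (r a)) ≤ ν (⋃ a ∈ u, ball (x a) (5 * r a)) := by
        apply measure_mono
        refine Set.iUnion₂_subset fun a ha => ?_
        obtain ⟨c, hc, hsub⟩ := hcov a ha
        exact hsub.trans (Set.subset_biUnion_of_mem (u := fun a => ball (x a) (5 * r a)) hc)
    _ ≤ ∑' a : u, ν (ball (x a) (5 * r a)) := measure_biUnion_le _ hcount _
    _ ≤ ∑' a : u, K * ν' (ball (x a) (r a)) := ENNReal.tsum_le_tsum fun a => hK a (hut a.2)
    _ = K * ∑' a : u, ν' (ball (x a) (r a)) := ENNReal.tsum_mul_left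
    _ = K * ν' (⋃ a ∈ u, ball (x a) (r a)) := by
        rw [measure_biUnion hcount hdis fun _ _ => measurableSet_ball]
    _ ≤ _ := by
        exact mul_le_mul' le_rfl (measure_mono (Set.biUnion_subset_biUnion_left hut))

theorem osc_nonneg {b : E → ℝ} {M : ℝ} (hM : Osc μ b M) : 0 ≤ M := by
  obtain ⟨c, hc⟩ := hM 0 1 one_pos
  have h1 : 0 ≤ ∫ y in ball (0:E) 1, |b y - c| ∂μ := integral_nonneg fun _ => abs_nonneg _
  have h2 := real_ball_pos μ (0:E) one_pos
  by_contra hneg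
  push Not at hneg
  nlinarith

theorem bt_local {r : E → ℝ} (hr : LipschitzWith (1/4) r) {b : E → ℝ}
    (hbl : LocallyIntegrable b μ) {M N : ℝ} (hM : Osc μ b M) (hN : ∀ x, |b x| ≤ N)
    {z : E} (h0 : 0 < r z) :
    ∫⁻ x in ball z (5 * (r z / 10)), ‖b x - bt μ r b x‖ₑ ∂μ ≤
      ENNReal.ofReal ((1 + 4 * 8 ^ finrank ℝ E) * 20 ^ finrank ℝ E * M) *
        μ (ball z (r z / 10)) := by
  obtain ⟨c, h1, h2, -⟩ := bt_facts μ hr hbl hM h0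
  have hM0 := osc_nonneg μ hM
  set D := finrank ℝ E
  have hsub : ball z (5 * (r z / 10)) ⊆ ball z (2 * r z) := ball_subset_ball (by linarith)
  have hsub2 : ball z (5 * (r z / 10)) = ball z (r z / 2) := by congr 1; ring
  have hbB1 : IntegrableOn b (ball z (2 * r z)) μ :=
    ((hbl.integrableOn_isCompact (isCompact_closedBall z (2 * r z))).mono_set
      ball_subset_closedBall)
  have hcB : ∀ c : ℝ, IntegrableOn (fun _ : E => c) (ball z (2 * r z)) μ := fun c =>
    integrableOn_const (by exact measure_ball_lt_top.ne)
  have hbt : IntegrableOn (bt μ r b) (ball z (2 * r z)) μ := by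
    refine Integrable.mono' (hcB N) (bt_meas μ hr hbl hM).aestronglyMeasurable ?_
    exact Filter.Eventually.of_forall fun x => bt_bdd μ hN x
  have hi : IntegrableOn (fun x => b x - bt μ r b x) (ball z (5 * (r z / 10))) μ :=
    (hbB1.sub hbt).mono_set hsub
  rw [← ofReal_integral_norm_eq_lintegral_enorm hi,
    ← ENNReal.ofReal_toReal (measure_ball_lt_top (μ := μ) (x := z) (r := r z / 10)).ne,
    ← ENNReal.ofReal_mul (by positivity)]
  apply ENNReal.ofReal_le_ofReal
  change _ ≤ _ * μ.real (ball z (r z / 10))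
  have hvol : μ.real (ball z (2 * r z)) = 20 ^ D * μ.real (ball z (r z / 10)) := by
    rw [← real_ball_scale μ z z (by norm_num)]; congr 2; ring
  have habs : IntegrableOn (fun y => |b y - c|) (ball z (2 * r z)) μ := (hbB1.sub (hcB c)).abs
  calc ∫ x in ball z (5 * (r z / 10)), ‖b x - bt μ r b x‖ ∂μ
      ≤ ∫ x in ball z (5 * (r z / 10)), (|b x - c| + 4 * 8 ^ D * M) ∂μ := by
        refine setIntegral_mono_on hi.norm ?_ measurableSet_ball ?_
        · exact (habs.add (hcB _)).mono_set hsub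
        · intro x hx
          rw [hsub2] at hx
          have := h2 x hx
          calc ‖b x - bt μ r b x‖ = |(b x - c) - (bt μ r b x - c)| := by
                rw [Real.norm_eq_abs]; congr 1; ring
            _ ≤ |b x - c| + |bt μ r b x - c| := abs_sub _ _
            _ ≤ _ := by gcongr
    _ ≤ ∫ x in ball z (2 * r z), (|b x - c| + 4 * 8 ^ D * M) ∂μ := by
        refine setIntegral_mono_set (habs.add (hcB _)) ?_ hsub.eventuallyLE
        exact Filter.Eventually.of_forall fun x => by
          have := abs_nonneg (b x - c); simp only [Pi.zero_apply]; positivity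
    _ = ∫ x in ball z (2 * r z), |b x - c| ∂μ + μ.real (ball z (2 * r z)) * (4 * 8 ^ D * M) := by
        rw [integral_add habs (hcB _), setIntegral_const, smul_eq_mul]
    _ ≤ M * μ.real (ball z (2 * r z)) + μ.real (ball z (2 * r z)) * (4 * 8 ^ D * M) := by gcongr
    _ = _ := by rw [hvol]; ring

theorem lip_pair [Nontrivial E] {Ω : Set E} (ho : IsOpen Ω) (hbd : Bornology.IsBounded Ω)
    {A B : ℝ≥0} {φ ψ : E → ℝ} (hφ : LipschitzWith A φ) (hψ : LipschitzWith B ψ)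
    (hφ0 : ∀ x, x ∉ Ω → φ x = 0) (hψc : HasCompactSupport ψ) {v w : E} (hv : ‖v‖ ≤ 1)
    (hw : ‖w‖ ≤ 1) {b : E → ℝ} (hbl : LocallyIntegrable b μ) {M N : ℝ} (hM : Osc μ b M)
    (hN : ∀ x, |b x| ≤ N) :
    |∫ x, b x * jac v w φ ψ x ∂μ| ≤
      (2 * ((1 + 4 * 8 ^ finrank ℝ E) * 20 ^ finrank ℝ E) +
        10 * (2 * 8 ^ finrank ℝ E * (2 + 8 * 8 ^ finrank ℝ E))) * A * B * M * μ.real Ω := by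
  have hM0 := osc_nonneg μ hM
  have hN0 : 0 ≤ N := (abs_nonneg _).trans (hN 0)
  set D := finrank ℝ E with hD
  set K3 : ℝ := (1 + 4 * 8 ^ D) * 20 ^ D with hK3
  set C1 : ℝ := 2 * 8 ^ D * (2 + 8 * 8 ^ D) with hC1
  have hK30 : 0 ≤ K3 := by positivity
  have hC10 : 0 ≤ C1 := by positivity
  have hne : (Ωᶜ).Nonempty := by
    rw [Set.nonempty_compl]
    rintro rfl
    exact NormedSpace.unbounded_univ ℝ E hbd
  have hcl : IsClosed Ωᶜ := ho.isClosed_compl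
  set r : E → ℝ := fun x => infDist x Ωᶜ / 4 with hrdef
  have hr : LipschitzWith (1/4) r := by
    refine LipschitzWith.of_dist_le_mul fun x y => ?_
    have := (lipschitz_infDist_pt Ωᶜ).dist_le_mul x y
    simp only [hrdef, Real.dist_eq, ← sub_div, abs_div] at *
    norm_num at *
    linarith
  have hr0 : ∀ x, 0 ≤ r x := fun x => by have := infDist_nonneg (x := x) (s := Ωᶜ); positivity
  have hrpos : ∀ x ∈ Ω, 0 < r x := by
    intro x hx
    have := (hcl.notMem_iff_infDist_pos hne).1 (not_not.2 hx : x ∉ Ωᶜ)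
    positivity
  have hr00 : ∀ x, x ∉ Ω → r x = 0 := by
    intro x hx
    have : infDist x Ωᶜ = 0 := infDist_zero_of_mem hx
    simp [hrdef, this]
  have hballΩ : ∀ x, ball x (4 * r x) ⊆ Ω := by
    intro x y hy
    by_contra hn
    have h1 : infDist x Ωᶜ ≤ dist x y := infDist_le_dist_of_mem hn
    rw [mem_ball, dist_comm] at hy
    simp only [hrdef] at hy
    linarith
  have hφr : ∀ x, |φ x| ≤ A * (4 * r x) := by
    intro x
    obtain ⟨y, hy, hxy⟩ := hcl.exists_infDist_eq_dist hne x
    have h := hφ.dist_le_mul x y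
    rw [hφ0 y hy, Real.dist_eq, sub_zero, ← hxy] at h
    simpa [hrdef, mul_div_cancel₀] using h.trans (le_of_eq (by ring))
  have hΩtop : μ Ω ≠ ⊤ := hbd.measure_lt_top.ne
  set β := bt μ r b with hβ
  have hβm : Measurable β := bt_meas μ hr hbl hM
  have hβN : ∀ x, |β x| ≤ N := bt_bdd μ hN
  -- local Lipschitz bound for β
  have hβl : ∀ x y, dist x y < r x / 2 → |β x - β y| ≤ C1 * M * dist x y / r x := by
    intro x y hxy
    have h0 : 0 < r x := by have := dist_nonneg (x := x) (y := y); linarith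
    obtain ⟨c, -, -, h3⟩ := bt_facts μ hr hbl hM h0
    exact h3 x (mem_ball_self (by positivity)) y (by rwa [mem_ball, dist_comm])
  -- L1 estimate
  have hL1 : ∫⁻ x in Ω, ‖b x - β x‖ₑ ∂μ ≤ ENNReal.ofReal (K3 * M) * μ Ω := by
    obtain ⟨y0, hy0⟩ := hne
    obtain ⟨R, hR⟩ := hbd.subset_ball y0
    have hrR : ∀ x ∈ Ω, r x / 10 ≤ R := by
      intro x hx
      have h1 : infDist x Ωᶜ ≤ dist x y0 := infDist_le_dist_of_mem hy0
      have h2 := hR hx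
      rw [mem_ball] at h2
      have := infDist_nonneg (x := x) (s := Ωᶜ)
      simp only [hrdef]
      linarith
    have hU : (⋃ a ∈ Ω, ball a (r a / 10)) = Ω := by
      apply Set.Subset.antisymm
      · refine Set.iUnion₂_subset fun a _ => (ball_subset_ball ?_).trans (hballΩ a)
        linarith [hr0 a]
      · intro x hx
        exact Set.mem_biUnion hx (mem_ball_self (by have := hrpos x hx; positivity))
    have h := vitali_measure (μ.withDensity fun x => ‖b x - β x‖ₑ) μ
      (ENNReal.ofReal (K3 * M)) Ω (fun x => x) (fun x => r x / 10) R hrR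
      (fun a ha => by have := hrpos a ha; positivity) ?_
    · rw [hU, withDensity_apply _ ho.measurableSet] at h
      exact h
    · intro a ha
      rw [withDensity_apply _ measurableSet_ball]
      exact bt_local μ hr hbl hM hN (hrpos a ha)
  have hbm : AEStronglyMeasurable b μ := hbl.aestronglyMeasurable
  have hdi : IntegrableOn (fun x => b x - β x) Ω μ := by
    refine ⟨(hbm.sub hβm.aestronglyMeasurable).restrict, ?_⟩
    exact hL1.trans_lt (ENNReal.mul_lt_top ENNReal.ofReal_lt_top hbd.measure_lt_top)
  have hL1' : ∫ x in Ω, |b x - β x| ∂μ ≤ K3 * M * μ.real Ω := by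
    have h1 := ofReal_integral_norm_eq_lintegral_enorm hdi
    rw [← h1, ← ENNReal.ofReal_toReal hΩtop, ← ENNReal.ofReal_mul (by positivity),
      ENNReal.ofReal_le_ofReal_iff (by positivity)] at hL1
    exact hL1
  -- the product
  set Φ : E → ℝ := fun x => φ x * β x with hΦd
  have near : ∀ x y, dist x y < r x / 2 →
      |Φ x - Φ y| ≤ (A * N + 5 * A * (C1 * M)) * dist x y := by
    intro x y hxy
    have h0 : 0 < r x := by have := dist_nonneg (x := x) (y := y); linarith
    have hry := (rad_close hr (x := y) (x0 := x) (by rwa [mem_ball, dist_comm])).2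
    have e : Φ x - Φ y = (φ x - φ y) * β x + φ y * (β x - β y) := by simp only [hΦd]; ring
    have h1 : |φ x - φ y| ≤ A * dist x y := hφ.dist_le_mul x y
    have h2 := hβl x y hxy
    have h3 : |φ y| ≤ A * (5 * r x) := (hφr y).trans (mul_le_mul_of_nonneg_left (by linarith) A.2)
    rw [e]
    calc _ ≤ |φ x - φ y| * |β x| + |φ y| * |β x - β y| := by
          rw [← abs_mul, ← abs_mul]; exact abs_add_le _ _
      _ ≤ A * dist x y * N + A * (5 * r x) * (C1 * M * dist x y / r x) := by
          gcongr; exact hβN x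
      _ = _ := by field_simp
  have hΦr : ∀ x, |Φ x| ≤ A * (4 * r x) * N := by
    intro x
    simp only [hΦd, abs_mul]
    have := hr0 x
    gcongr
    · exact hφr x
    · exact hβN x
  have hΦL : LipschitzWith (Real.toNNReal (16 * A * N + 5 * A * (C1 * M))) Φ := by
    refine LipschitzWith.of_dist_le_mul fun x y => ?_
    rw [Real.coe_toNNReal _ (by positivity), Real.dist_eq]
    have hd := dist_nonneg (x := x) (y := y)
    have hAN : (A * N + 5 * A * (C1 * M)) * dist x y
        ≤ (16 * A * N + 5 * A * (C1 * M)) * dist x y := by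
      have : 0 ≤ A * N := by positivity
      gcongr
      linarith
    by_cases h1 : dist x y < r x / 2
    · exact (near x y h1).trans hAN
    by_cases h2 : dist x y < r y / 2
    · rw [abs_sub_comm]
      refine (near y x (by rwa [dist_comm])).trans ?_
      rw [dist_comm y x]; exact hAN
    push Not at h1 h2
    calc |Φ x - Φ y| ≤ |Φ x| + |Φ y| := abs_sub _ _
      _ ≤ A * (4 * r x) * N + A * (4 * r y) * N := add_le_add (hΦr x) (hΦr y)
      _ ≤ A * (4 * (2 * dist x y)) * N + A * (4 * (2 * dist x y)) * N := by
          gcongr <;> linarith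
      _ = 16 * A * N * dist x y := by ring
      _ ≤ _ := by
          gcongr
          have : 0 ≤ 5 * A * (C1 * M) := by positivity
          linarith
  have hΦ0 : ∀ x, x ∉ Ω → Φ x = 0 := fun x hx => by simp [hΦd, hφ0 x hx]
  have hcomp : ∀ {χ : E → ℝ}, (∀ x, x ∉ Ω → χ x = 0) → HasCompactSupport χ := by
    intro χ h
    exact HasCompactSupport.intro hbd.isCompact_closure fun x hx => h x fun h' => hx (subset_closure h')
  have hφc := hcomp hφ0
  have hΦc := hcomp hΦ0
  -- pointwise estimates
  have hψd : ∀ x u, ‖u‖ ≤ 1 → |lineDeriv ℝ ψ x u| ≤ B := fun x u hu =>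
    (norm_lineDeriv_le_of_lipschitz ℝ hψ).trans (mul_le_of_le_one_right B.2 hu)
  have hφd : ∀ x u, ‖u‖ ≤ 1 → |lineDeriv ℝ φ x u| ≤ A := fun x u hu =>
    (norm_lineDeriv_le_of_lipschitz ℝ hφ).trans (mul_le_of_le_one_right A.2 hu)
  have hdiff : ∀ u : E, ‖u‖ ≤ 1 → ∀ᵐ x ∂μ, x ∈ Ω →
      |lineDeriv ℝ Φ x u - β x * lineDeriv ℝ φ x u| ≤ 5 * A * (C1 * M) := by
    intro u hu
    filter_upwards [hΦL.ae_lineDifferentiableAt (μ := μ) u,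
      hφ.ae_lineDifferentiableAt (μ := μ) u] with x h1 h2 hx
    have h3 : HasLineDerivAt ℝ (fun y => Φ y - β x * φ y)
        (lineDeriv ℝ Φ x u - β x * lineDeriv ℝ φ x u) x u :=
      HasDerivAt.sub h1.hasLineDerivAt (HasDerivAt.const_mul (β x) h2.hasLineDerivAt)
    rw [← h3.lineDeriv]
    have h4 : ‖lineDeriv ℝ (fun y => Φ y - β x * φ y) x u‖ ≤ 5 * A * (C1 * M) * ‖u‖ := by
      refine norm_lineDeriv_le_of_lip' ℝ (by positivity) ?_
      have h0 := hrpos x hx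
      filter_upwards [ball_mem_nhds x (half_pos h0)] with y hy
      have hy' : dist x y < r x / 2 := by rwa [mem_ball, dist_comm] at hy
      have hry := (rad_close hr hy).2
      have e : (Φ y - β x * φ y) - (Φ x - β x * φ x) = φ y * (β y - β x) := by
        simp only [hΦd]; ring
      rw [e, norm_mul, Real.norm_eq_abs, Real.norm_eq_abs, abs_sub_comm, ← dist_eq_norm, dist_comm]
      have h5 : |φ y| ≤ A * (5 * r x) := (hφr y).trans (mul_le_mul_of_nonneg_left (by linarith) A.2)
      calc _ ≤ A * (5 * r x) * (C1 * M * dist x y / r x) := by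
            gcongr; exact hβl x y hy'
        _ = _ := by field_simp
    exact h4.trans (mul_le_of_le_one_right (by positivity) hu)
  have hjΦ : Integrable (fun x => jac v w Φ ψ x) μ := by
    simpa using integrable_bdd_mul_jac μ hΦL hψ hψc v w (b := fun _ => 1) (N := 1)
      aestronglyMeasurable_const (by simp)
  have hjb := integrable_bdd_mul_jac μ hφ hψ hψc v w hbm hN
  have hjβ := integrable_bdd_mul_jac μ hφ hψ hψc v w hβm.aestronglyMeasurable hβN
  have hz : ∀ᵐ x ∂μ, x ∉ Ω → jac v w φ ψ x = 0 ∧ jac v w Φ ψ x = 0 := by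
    filter_upwards [ae_lineDeriv_eq_zero μ hφ v, ae_lineDeriv_eq_zero μ hφ w,
      ae_lineDeriv_eq_zero μ hΦL v, ae_lineDeriv_eq_zero μ hΦL w] with x h1 h2 h3 h4 hx
    simp [jac, h1 (hφ0 x hx), h2 (hφ0 x hx), h3 (hΦ0 x hx), h4 (hΦ0 x hx)]
  have hjb' : ∀ x, |jac v w φ ψ x| ≤ 2 * (A * B) := by
    intro x
    unfold jac
    calc _ ≤ |lineDeriv ℝ φ x v| * |lineDeriv ℝ ψ x w| + |lineDeriv ℝ φ x w| * |lineDeriv ℝ ψ x v| := by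
          rw [← abs_mul, ← abs_mul]; exact abs_sub _ _
      _ ≤ A * B + A * B := by
          gcongr <;> first | exact hφd _ _ ‹_› | exact hψd _ _ ‹_›
      _ = _ := by ring
  have e0 : ∫ x, b x * jac v w φ ψ x ∂μ =
      ∫ x, (b x - β x) * jac v w φ ψ x ∂μ + ∫ x, (β x * jac v w φ ψ x - jac v w Φ ψ x) ∂μ := by
    rw [integral_sub hjβ hjΦ, integral_jac_eq_zero μ hΦL hΦc hψ hψc v w, sub_zero]
    simp_rw [sub_mul]
    rw [integral_sub hjb hjβ]; ring
  have e1 : |∫ x, (b x - β x) * jac v w φ ψ x ∂μ| ≤ 2 * (A * B) * (K3 * M * μ.real Ω) := by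
    have : |∫ x, (b x - β x) * jac v w φ ψ x ∂μ| ≤
        ∫ x, Ω.indicator (fun x => 2 * (A * B) * |b x - β x|) x ∂μ := by
      refine norm_integral_le_of_norm_le (f := fun x => (b x - β x) * jac v w φ ψ x) ?_ ?_
      · rw [integrable_indicator_iff ho.measurableSet]
        exact hdi.abs.const_mul _
      · filter_upwards [hz] with x hx
        by_cases h : x ∈ Ω
        · rw [Set.indicator_of_mem h, norm_mul, Real.norm_eq_abs, Real.norm_eq_abs, mul_comm]
          exact mul_le_mul_of_nonneg_right (hjb' x) (abs_nonneg _)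
        · rw [Set.indicator_of_notMem h, (hx h).1]; simp
    refine this.trans ?_
    rw [integral_indicator ho.measurableSet, integral_const_mul]
    gcongr
  have e2 : |∫ x, (β x * jac v w φ ψ x - jac v w Φ ψ x) ∂μ| ≤
      10 * A * (C1 * M) * B * μ.real Ω := by
    have : |∫ x, (β x * jac v w φ ψ x - jac v w Φ ψ x) ∂μ| ≤
        ∫ x, Ω.indicator (fun _ => 10 * A * (C1 * M) * B) x ∂μ := by
      refine norm_integral_le_of_norm_le (f := fun x => β x * jac v w φ ψ x - jac v w Φ ψ x) ?_ ?_
      · rw [integrable_indicator_iff ho.measurableSet]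
        exact integrableOn_const hΩtop
      · filter_upwards [hz, hdiff v hv, hdiff w hw] with x hx h1 h2
        by_cases h : x ∈ Ω
        · rw [Set.indicator_of_mem h, Real.norm_eq_abs]
          have e : β x * jac v w φ ψ x - jac v w Φ ψ x =
            (lineDeriv ℝ Φ x w - β x * lineDeriv ℝ φ x w) * lineDeriv ℝ ψ x v
            - (lineDeriv ℝ Φ x v - β x * lineDeriv ℝ φ x v) * lineDeriv ℝ ψ x w := by
            unfold jac; ring
          rw [e]
          refine (abs_sub _ _).trans ?_
          rw [abs_mul, abs_mul]
          calc _ ≤ 5 * A * (C1 * M) * B + 5 * A * (C1 * M) * B := by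
                gcongr
                · exact h2 h
                · exact hψd _ _ hv
                · exact h1 h
                · exact hψd _ _ hw
            _ = _ := by ring
        · rw [Set.indicator_of_notMem h, (hx h).1, (hx h).2]; simp
    refine this.trans ?_
    rw [integral_indicator ho.measurableSet, setIntegral_const, smul_eq_mul, mul_comm]
  rw [e0]
  refine (abs_add_le _ _).trans ((add_le_add e1 e2).trans (le_of_eq ?_))
  ring

end P3

section P4
set_option linter.unusedSectionVars false
open Module
variable {E : Type*} [NormedAddCommGroup E] [NormedSpace ℝ E] [FiniteDimensional ℝ E]
  [MeasurableSpace E] [BorelSpace E] (μ : Measure E) [μ.IsAddHaarMeasure]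

/-- Balls with large average of `h`. -/
def Bad (h : E → ℝ) (l : ℝ) : Set (E × ℝ) :=
  {p | 0 < p.2 ∧ l * μ.real (ball p.1 p.2) < ∫ z in ball p.1 p.2, h z ∂μ}

/-- Super level set of the uncentred maximal function. -/
def Om (h : E → ℝ) (l : ℝ) : Set E := ⋃ p ∈ Bad μ h l, ball p.1 p.2

theorem om_open (h : E → ℝ) (l : ℝ) : IsOpen (Om μ h l) :=
  isOpen_biUnion fun _ _ => isOpen_ball

theorem om_anti (h : E → ℝ) {l l' : ℝ} (hl : l ≤ l') : Om μ h l' ⊆ Om μ h l := by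
  refine Set.biUnion_subset_biUnion_left fun p hp => ⟨hp.1, lt_of_le_of_lt ?_ hp.2⟩
  exact mul_le_mul_of_nonneg_right hl measureReal_nonneg

theorem om_not {h : E → ℝ} {l : ℝ} {x : E} (hx : x ∉ Om μ h l) {r : ℝ} (hr : 0 < r) :
    ∫ z in ball x r, h z ∂μ ≤ l * μ.real (ball x r) := by
  by_contra hlt
  push Not at hlt
  exact hx (Set.mem_biUnion (x := (x, r)) ⟨hr, hlt⟩ (mem_ball_self hr))

theorem om_empty {h : E → ℝ} (hc : Continuous h) (hs : HasCompactSupport h) {l : ℝ}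
    (hl : ∀ x, h x ≤ l) : Om μ h l = ∅ := by
  refine Set.eq_empty_of_forall_notMem fun x hx => ?_
  simp only [Om, Set.mem_iUnion] at hx
  obtain ⟨p, hp, -⟩ := hx
  refine absurd hp.2 (not_lt.2 ?_)
  calc ∫ z in ball p.1 p.2, h z ∂μ ≤ ∫ z in ball p.1 p.2, l ∂μ := by
        refine integral_mono (hc.integrable_of_hasCompactSupport hs).integrableOn
          (integrableOn_const (by exact measure_ball_lt_top.ne)) hl
    _ = _ := by simp [mul_comm]

theorem bad_radius [Nontrivial E] {h : E → ℝ} (hc : Continuous h) (hs : HasCompactSupport h)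
    (h0 : ∀ x, 0 ≤ h x) {l : ℝ} (hl : 0 < l) : ∃ R, ∀ p ∈ Bad μ h l, p.2 ≤ R := by
  have hi := hc.integrable_of_hasCompactSupport (μ := μ) hs
  have hV := real_ball_pos μ (0:E) one_pos
  refine ⟨max 1 ((∫ x, h x ∂μ) / (l * μ.real (ball (0:E) 1))), fun p hp => ?_⟩
  obtain ⟨h1, h2⟩ := hp
  by_cases hp1 : p.2 ≤ 1
  · exact hp1.trans (le_max_left _ _)
  push Not at hp1
  refine le_trans ?_ (le_max_right _ _)
  rw [le_div_iff₀ (by positivity)]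
  have h3 : ∫ z in ball p.1 p.2, h z ∂μ ≤ ∫ x, h x ∂μ :=
    setIntegral_le_integral hi (Filter.Eventually.of_forall h0)
  have h4 := real_ball_scale μ p.1 (0:E) h1 (ρ := 1)
  rw [mul_one] at h4
  rw [h4] at h2
  have h5 : p.2 ≤ p.2 ^ finrank ℝ E := le_self_pow₀ hp1.le (finrank_pos).ne'
  nlinarith [mul_le_mul_of_nonneg_right h5 (mul_pos hl hV).le]

theorem om_bounded [Nontrivial E] {h : E → ℝ} (hc : Continuous h) (hs : HasCompactSupport h)
    (h0 : ∀ x, 0 ≤ h x) {l : ℝ} (hl : 0 < l) : Bornology.IsBounded (Om μ h l) := by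
  obtain ⟨R, hR⟩ := bad_radius μ hc hs h0 hl
  obtain ⟨S, hS⟩ := hs.isBounded.subset_closedBall (0:E)
  refine (isBounded_closedBall (x := (0:E)) (r := S + 2 * R)).subset ?_
  refine Set.iUnion₂_subset fun p hp y hy => ?_
  have hr := hR p hp
  have : ∃ z ∈ ball p.1 p.2, h z ≠ 0 := by
    by_contra hcon
    push Not at hcon
    have := hp.2
    rw [setIntegral_congr_fun measurableSet_ball (g := fun _ => 0) (fun z hz => hcon z hz)] at this
    simp only [integral_zero] at this
    have := mul_nonneg hl.le (measureReal_nonneg (μ := μ) (s := ball p.1 p.2))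
    linarith
  obtain ⟨z, hz, hz0⟩ := this
  have hz1 := hS (subset_tsupport h hz0)
  rw [mem_closedBall] at *
  rw [mem_ball] at *
  have h1 := dist_triangle y p.1 0
  have h2 := dist_triangle_left p.1 0 z
  linarith

theorem om_weak [Nontrivial E] {h : E → ℝ} (hc : Continuous h) (hs : HasCompactSupport h)
    (h0 : ∀ x, 0 ≤ h x) {l : ℝ} (hl : 0 < l) :
    μ.real (Om μ h l) ≤ 5 ^ finrank ℝ E * (2 / l) * ∫ x in {x | l / 2 < h x}, h x ∂μ := by
  obtain ⟨R, hR⟩ := bad_radius μ hc hs h0 hl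
  have hi := hc.integrable_of_hasCompactSupport (μ := μ) hs
  set S := {x | l / 2 < h x} with hSd
  have hSm : MeasurableSet S := measurableSet_lt measurable_const hc.measurable
  set ν' : Measure E := (μ.restrict S).withDensity (fun x => ENNReal.ofReal (h x)) with hν
  have hν' : ∀ s, MeasurableSet s → ν' s = ENNReal.ofReal (∫ x in s ∩ S, h x ∂μ) := by
    intro s hms
    rw [hν, withDensity_apply _ hms, Measure.restrict_restrict hms,
      ofReal_integral_eq_lintegral_ofReal hi.integrableOn (Filter.Eventually.of_forall h0)]
  have key : ∀ p ∈ Bad μ h l, μ (ball p.1 (5 * p.2)) ≤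
      ENNReal.ofReal (5 ^ finrank ℝ E * (2 / l)) * ν' (ball p.1 p.2) := by
    intro p hp
    rw [hν' _ measurableSet_ball, ← ENNReal.ofReal_mul (by positivity),
      ← ENNReal.ofReal_toReal (measure_ball_lt_top (μ := μ) (x := p.1) (r := 5 * p.2)).ne]
    apply ENNReal.ofReal_le_ofReal
    change μ.real _ ≤ _
    rw [real_ball_scale μ p.1 p.1 (by norm_num : (0:ℝ) < 5), mul_assoc]
    refine mul_le_mul_of_nonneg_left ?_ (by positivity)
    have h1 : ∫ x in ball p.1 p.2, h x ∂μ ≤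
        ∫ x in ball p.1 p.2, (l / 2 + S.indicator h x) ∂μ := by
      refine integral_mono hi.integrableOn ((integrableOn_const
        (by exact measure_ball_lt_top.ne)).add (hi.indicator hSm).integrableOn) fun x => ?_
      by_cases hx : x ∈ S
      · simp only [Set.indicator_of_mem hx]; linarith
      · simp only [Set.indicator_of_notMem hx]
        have : ¬ (l / 2 < h x) := hx
        linarith
    have hcI : Integrable (fun _ : E => l / 2) (μ.restrict (ball p.1 p.2)) :=
      integrableOn_const (by exact measure_ball_lt_top.ne)
    rw [integral_add hcI
      (hi.indicator hSm).integrableOn, setIntegral_indicator hSm] at h1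
    simp only [integral_const, smul_eq_mul, measureReal_restrict_apply MeasurableSet.univ,
      Set.univ_inter] at h1
    have h2 := hp.2
    rw [div_mul_eq_mul_div, le_div_iff₀ hl]
    linarith
  have hv := vitali_measure μ ν' _ (Bad μ h l) Prod.fst Prod.snd R hR (fun p hp => hp.1) key
  have hfin : ν' (Om μ h l) ≤ ENNReal.ofReal (∫ x in S, h x ∂μ) := by
    rw [hν' _ (om_open μ h l).measurableSet]
    apply ENNReal.ofReal_le_ofReal
    exact setIntegral_mono_set hi.integrableOn (Filter.Eventually.of_forall h0)
      (Filter.Eventually.of_forall Set.inter_subset_right)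
  have h3 : μ (Om μ h l) ≤ ENNReal.ofReal (5 ^ finrank ℝ E * (2 / l) * ∫ x in S, h x ∂μ) := by
    rw [ENNReal.ofReal_mul (by positivity)]
    exact hv.trans (mul_le_mul' le_rfl hfin)
  have h4 : 0 ≤ ∫ x in S, h x ∂μ := integral_nonneg h0
  exact ENNReal.toReal_le_of_le_ofReal (by positivity) h3
end P4

section P5
set_option linter.unusedSectionVars false
open Module
variable {E : Type*} [NormedAddCommGroup E] [NormedSpace ℝ E] [FiniteDimensional ℝ E]
  [MeasurableSpace E] [BorelSpace E] (μ : Measure E) [μ.IsAddHaarMeasure]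

theorem ftc_bound {f h : E → ℝ} (hf : ContDiff ℝ 1 f) (hc : Continuous h)
    (hfh : ∀ x, ‖fderiv ℝ f x‖ ≤ h x) (x u : E) :
    |f (x + u) - f x| ≤ ‖u‖ * ∫ t in Set.Ioc (0:ℝ) 1, h (x + t • u) := by
  have hd : ∀ t ∈ Set.uIcc (0:ℝ) 1,
      HasDerivAt (fun t : ℝ => f (x + t • u)) (fderiv ℝ f (x + t • u) u) t := by
    intro t _
    have h1 : HasFDerivAt f (fderiv ℝ f (x + t • u)) (x + t • u) :=
      (hf.differentiable (by norm_num) _).hasFDerivAt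
    have h2 : HasDerivAt (fun t : ℝ => x + t • u) u t := by
      simpa using ((hasDerivAt_id t).smul_const u).const_add x
    exact h1.comp_hasDerivAt t h2
  have hcd : Continuous (fun t : ℝ => fderiv ℝ f (x + t • u) u) :=
    ((hf.continuous_fderiv (by norm_num)).comp (by fun_prop)).clm_apply continuous_const
  have e := intervalIntegral.integral_eq_sub_of_hasDerivAt hd (hcd.intervalIntegrable _ _)
  simp only [one_smul, zero_smul, add_zero] at e
  rw [← e, intervalIntegral.integral_of_le zero_le_one, ← integral_const_mul, ← Real.norm_eq_abs]
  have hch : Continuous (fun t : ℝ => ‖u‖ * h (x + t • u)) := by fun_prop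
  refine norm_integral_le_of_norm_le (hch.integrableOn_Ioc) (Filter.Eventually.of_forall fun t => ?_)
  refine (ContinuousLinearMap.le_opNorm _ _).trans ?_
  rw [mul_comm]
  exact mul_le_mul_of_nonneg_left (hfh _) (norm_nonneg _)

theorem scaled_avg {h : E → ℝ} (x : E) {t r : ℝ} (ht : 0 < t) :
    ∫ u in ball (0:E) r, h (x + t • u) ∂μ = (t ^ finrank ℝ E)⁻¹ * ∫ z in ball x (t * r), h z ∂μ := by
  rw [Measure.setIntegral_comp_smul_of_pos μ (fun w => h (x + w)) (ball (0:E) r) ht,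
    _root_.smul_ball ht.ne', smul_eq_mul, smul_zero, Real.norm_of_nonneg ht.le]
  congr 1
  have := (measurePreserving_add_left μ x).setIntegral_preimage_emb
    (measurableEmbedding_addLeft x) h (ball x (t * r))
  rw [← this]
  congr 2
  ext w
  simp

theorem avg_diff {f h : E → ℝ} (hf : ContDiff ℝ 1 f) (hc : Continuous h)
    (hfh : ∀ x, ‖fderiv ℝ f x‖ ≤ h x) {l : ℝ} (hl : 0 ≤ l) {x : E}
    (hx : ∀ r, 0 < r → ∫ z in ball x r, h z ∂μ ≤ l * μ.real (ball x r)) {r : ℝ} (hr : 0 < r) :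
    ∫ z in ball x r, |f z - f x| ∂μ ≤ l * r * μ.real (ball x r) := by
  have h0 : ∀ x, 0 ≤ h x := fun x => (norm_nonneg _).trans (hfh x)
  have e1 : ∫ z in ball x r, |f z - f x| ∂μ = ∫ u in ball (0:E) r, |f (x + u) - f x| ∂μ := by
    have := scaled_avg μ (h := fun z => |f z - f x|) x (t := 1) (r := r) one_pos
    simpa using this.symm
  have hfc := hf.continuous
  rw [e1, integral_eq_lintegral_of_nonneg_ae (Filter.Eventually.of_forall fun _ => abs_nonneg _)
    (by fun_prop)]
  have hV := real_ball_pos μ x hr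
  refine ENNReal.toReal_le_of_le_ofReal (by positivity) ?_
  have hbint : ∀ {k : E → ℝ}, Continuous k → IntegrableOn k (ball (0:E) r) μ := fun hk =>
    (hk.locallyIntegrable.integrableOn_isCompact (isCompact_closedBall (0:E) r)).mono_set
      ball_subset_closedBall
  calc ∫⁻ u in ball (0:E) r, ENNReal.ofReal |f (x + u) - f x| ∂μ
      ≤ ∫⁻ u in ball (0:E) r, (∫⁻ t in Set.Ioc (0:ℝ) 1, ENNReal.ofReal (r * h (x + t • u))) ∂μ := by
        refine setLIntegral_mono' measurableSet_ball fun u hu => ?_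
        have hch : Continuous (fun t : ℝ => r * h (x + t • u)) := by fun_prop
        rw [← ofReal_integral_eq_lintegral_ofReal (hch.integrableOn_Ioc)
          (Filter.Eventually.of_forall fun t => mul_nonneg hr.le (h0 _))]
        refine ENNReal.ofReal_le_ofReal ((ftc_bound hf hc hfh x u).trans ?_)
        rw [integral_const_mul]
        refine mul_le_mul_of_nonneg_right ?_ (integral_nonneg fun t => h0 _)
        simpa using (mem_ball_zero_iff.1 hu).le
    _ = ∫⁻ t in Set.Ioc (0:ℝ) 1, (∫⁻ u in ball (0:E) r, ENNReal.ofReal (r * h (x + t • u)) ∂μ) := by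
        refine lintegral_lintegral_swap ?_
        refine Measurable.aemeasurable ?_
        refine ENNReal.measurable_ofReal.comp ?_
        have : Continuous (fun p : E × ℝ => r * h (x + p.2 • p.1)) := by fun_prop
        exact this.measurable
    _ ≤ ∫⁻ t in Set.Ioc (0:ℝ) 1, ENNReal.ofReal (l * r * μ.real (ball x r)) := by
        refine setLIntegral_mono' measurableSet_Ioc fun t ht => ?_
        rw [← ofReal_integral_eq_lintegral_ofReal (hbint (by fun_prop))
          (Filter.Eventually.of_forall fun t => mul_nonneg hr.le (h0 _))]
        refine ENNReal.ofReal_le_ofReal ?_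
        rw [integral_const_mul, scaled_avg μ x ht.1]
        have h1 := hx (t * r) (mul_pos ht.1 hr)
        rw [real_ball_scale μ x x ht.1] at h1
        have htp : 0 < t ^ finrank ℝ E := pow_pos ht.1 _
        have h2 : (t ^ finrank ℝ E)⁻¹ * ∫ z in ball x (t * r), h z ∂μ ≤ l * μ.real (ball x r) := by
          rw [inv_mul_le_iff₀ htp]; linarith
        nlinarith [mul_le_mul_of_nonneg_left h2 hr.le]
    _ = _ := by simp

theorem hajlasz {f h : E → ℝ} (hf : ContDiff ℝ 1 f) (hc : Continuous h)
    (hfh : ∀ x, ‖fderiv ℝ f x‖ ≤ h x) {l : ℝ} (hl : 0 ≤ l) {x y : E}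
    (hx : ∀ r, 0 < r → ∫ z in ball x r, h z ∂μ ≤ l * μ.real (ball x r))
    (hy : ∀ r, 0 < r → ∫ z in ball y r, h z ∂μ ≤ l * μ.real (ball y r)) :
    |f x - f y| ≤ 2 ^ (finrank ℝ E + 1) * l * dist x y := by
  rcases eq_or_ne x y with rfl | hne
  · simp
  have hr : 0 < dist x y := dist_pos.2 hne
  set r := dist x y with hrd
  set m := midpoint ℝ x y with hm
  have hs1 : ball m (r / 2) ⊆ ball x r := by
    apply ball_subset_ball'
    have : dist m x = r / 2 := by rw [hm, dist_midpoint_left]; simp; ring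
    linarith
  have hs2 : ball m (r / 2) ⊆ ball y r := by
    apply ball_subset_ball'
    have : dist m y = r / 2 := by rw [hm, dist_midpoint_right]; simp; ring
    linarith
  have h1 := avg_diff μ hf hc hfh hl hx hr
  have h2 := avg_diff μ hf hc hfh hl hy hr
  have hfc := hf.continuous
  have hbint : ∀ {k : E → ℝ} (z : E) (r : ℝ), Continuous k → IntegrableOn k (ball z r) μ :=
    fun z r hk => (hk.locallyIntegrable.integrableOn_isCompact (isCompact_closedBall z r)).mono_set
      ball_subset_closedBall
  have h3 : ∫ z in ball m (r / 2), |f z - f x| ∂μ ≤ ∫ z in ball x r, |f z - f x| ∂μ :=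
    setIntegral_mono_set (hbint _ _ (by fun_prop)) (Filter.Eventually.of_forall fun _ => abs_nonneg _)
      (Filter.Eventually.of_forall hs1)
  have h4 : ∫ z in ball m (r / 2), |f z - f y| ∂μ ≤ ∫ z in ball y r, |f z - f y| ∂μ :=
    setIntegral_mono_set (hbint _ _ (by fun_prop)) (Filter.Eventually.of_forall fun _ => abs_nonneg _)
      (Filter.Eventually.of_forall hs2)
  have h5 : ∫ z in ball m (r / 2), |f x - f y| ∂μ ≤
      ∫ z in ball m (r / 2), (|f z - f x| + |f z - f y|) ∂μ := by
    refine integral_mono (hbint _ _ (by fun_prop)) (hbint _ _ (by fun_prop)) fun z => ?_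
    have := abs_sub_le (f x) (f z) (f y)
    rwa [abs_sub_comm (f x) (f z)] at this
  have i1 : Integrable (fun z => |f z - f x|) (μ.restrict (ball m (r / 2))) :=
    hbint _ _ (by fun_prop)
  have i2 : Integrable (fun z => |f z - f y|) (μ.restrict (ball m (r / 2))) :=
    hbint _ _ (by fun_prop)
  rw [integral_add i1 i2] at h5
  simp only [integral_const, smul_eq_mul, measureReal_restrict_apply MeasurableSet.univ,
    Set.univ_inter] at h5
  have hV := real_ball_pos μ m (half_pos hr)
  have s1 := real_ball_scale μ x m (c := 2) (ρ := r / 2) (by norm_num)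
  have s2 := real_ball_scale μ y m (c := 2) (ρ := r / 2) (by norm_num)
  rw [show 2 * (r / 2) = r by ring] at s1 s2
  rw [s1] at h1
  rw [s2] at h2
  rw [pow_succ]
  refine le_of_mul_le_mul_left ?_ hV
  linarith

theorem lip_trunc {f h : E → ℝ} (hf : ContDiff ℝ 1 f) (hc : Continuous h)
    (hfh : ∀ x, ‖fderiv ℝ f x‖ ≤ h x) (l : ℝ≥0) :
    ∃ F : E → ℝ, LipschitzWith (2 ^ (finrank ℝ E + 1) * l) F ∧
      ∀ x, x ∉ Om μ h l → F x = f x := by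
  have hl : LipschitzOnWith (2 ^ (finrank ℝ E + 1) * l) f (Om μ h l)ᶜ := by
    refine LipschitzOnWith.of_dist_le_mul fun x hx y hy => ?_
    have := hajlasz μ hf hc hfh l.2 (fun r hr => om_not μ hx hr) (fun r hr => om_not μ hy hr)
    simpa [Real.dist_eq] using this
  obtain ⟨F, h1, h2⟩ := hl.extend_real
  exact ⟨F, h1, fun x hx => (h2 hx).symm⟩
end P5

section P6
set_option linter.unusedSectionVars false
open Module
variable {E : Type*} [NormedAddCommGroup E] [NormedSpace ℝ E] [FiniteDimensional ℝ E]
  [MeasurableSpace E] [BorelSpace E] (μ : Measure E) [μ.IsAddHaarMeasure]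

theorem jac_antisymm (v w : E) (φ ψ : E → ℝ) (x : E) : jac v w φ ψ x = - jac v w ψ φ x := by
  simp only [jac]; ring

theorem pair_antisymm (v w : E) (φ ψ b : E → ℝ) :
    ∫ x, b x * jac v w φ ψ x ∂μ = - ∫ x, b x * jac v w ψ φ x ∂μ := by
  rw [← integral_neg]
  congr 1
  ext x
  rw [jac_antisymm]; ring

theorem pair_sub {A A' B : ℝ≥0} {φ φ' ψ : E → ℝ} (hφ : LipschitzWith A φ)
    (hφ' : LipschitzWith A' φ') (hψ : LipschitzWith B ψ) (hψc : HasCompactSupport ψ)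
    (v w : E) {b : E → ℝ} {N : ℝ} (hb : AEStronglyMeasurable b μ) (hN : ∀ x, |b x| ≤ N) :
    ∫ x, b x * jac v w (fun y => φ y - φ' y) ψ x ∂μ =
      ∫ x, b x * jac v w φ ψ x ∂μ - ∫ x, b x * jac v w φ' ψ x ∂μ := by
  rw [← integral_sub (integrable_bdd_mul_jac μ hφ hψ hψc v w hb hN)
    (integrable_bdd_mul_jac μ hφ' hψ hψc v w hb hN)]
  refine integral_congr_ae ?_
  filter_upwards [hφ.ae_lineDifferentiableAt (μ := μ) v, hφ.ae_lineDifferentiableAt (μ := μ) w,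
    hφ'.ae_lineDifferentiableAt (μ := μ) v, hφ'.ae_lineDifferentiableAt (μ := μ) w] with x h1 h2 h3 h4
  have e1 : lineDeriv ℝ (fun y => φ y - φ' y) x v = lineDeriv ℝ φ x v - lineDeriv ℝ φ' x v :=
    deriv_fun_sub h1 h3
  have e2 : lineDeriv ℝ (fun y => φ y - φ' y) x w = lineDeriv ℝ φ x w - lineDeriv ℝ φ' x w :=
    deriv_fun_sub h2 h4
  simp only [jac, e1, e2]; ring

theorem dyadic_sum {l s : ℝ} (hl : 0 < l) (hs : 0 ≤ s) (T : ℕ) :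
    ∑ k ∈ Finset.range T, l * 2 ^ k * (if l * 2 ^ k / 2 < s then 1 else 0) ≤
      min (l * 2 ^ T) (4 * s) := by
  induction T with
  | zero => simp; constructor <;> positivity
  | succ T ih =>
    rw [Finset.sum_range_succ]
    have h1 := ih.trans (min_le_left _ _)
    have h2 := ih.trans (min_le_right _ _)
    have hp : 0 < l * 2 ^ T := by positivity
    rw [pow_succ]
    split_ifs with h
    · apply le_min <;> linarith
    · apply le_min <;> linarith

theorem om_sum [Nontrivial E] {h : E → ℝ} (hc : Continuous h) (hs : HasCompactSupport h)
    (h0 : ∀ x, 0 ≤ h x) {l : ℝ} (hl : 0 < l) (T : ℕ) :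
    ∑ k ∈ Finset.range T, (l * 2 ^ k) ^ 2 * μ.real (Om μ h (l * 2 ^ k)) ≤
      8 * 5 ^ finrank ℝ E * ∫ x, h x ^ 2 ∂μ := by
  have hi := hc.integrable_of_hasCompactSupport (μ := μ) hs
  have hm : ∀ k : ℕ, MeasurableSet {x | l * 2 ^ k / 2 < h x} := fun k =>
    measurableSet_lt measurable_const hc.measurable
  have hi2 : Integrable (fun x => h x ^ 2) μ := by
    have hs2 : HasCompactSupport (fun x => h x ^ 2) := by
      refine hs.mono fun x hx => ?_
      rw [Function.mem_support] at hx ⊢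
      intro hz
      rw [hz] at hx
      simp at hx
    have hc2 : Continuous (fun x => h x ^ 2) := by fun_prop
    exact hc2.integrable_of_hasCompactSupport hs2
  calc ∑ k ∈ Finset.range T, (l * 2 ^ k) ^ 2 * μ.real (Om μ h (l * 2 ^ k))
      ≤ ∑ k ∈ Finset.range T, 2 * 5 ^ finrank ℝ E *
        ∫ x, l * 2 ^ k * {x | l * 2 ^ k / 2 < h x}.indicator h x ∂μ := by
        refine Finset.sum_le_sum fun k _ => ?_
        have hlk : 0 < l * 2 ^ k := by positivity
        have := om_weak μ hc hs h0 hlk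
        rw [integral_const_mul, integral_indicator (hm k)]
        generalize ∫ x in {x | l * 2 ^ k / 2 < h x}, h x ∂μ = I at this ⊢
        generalize μ.real (Om μ h (l * 2 ^ k)) = m at this ⊢
        generalize l * 2 ^ k = a at this hlk ⊢
        calc a ^ 2 * m ≤ a ^ 2 * (5 ^ finrank ℝ E * (2 / a) * I) :=
              mul_le_mul_of_nonneg_left this (by positivity)
          _ = _ := by field_simp
    _ = 2 * 5 ^ finrank ℝ E * ∫ x, ∑ k ∈ Finset.range T,
          l * 2 ^ k * {x | l * 2 ^ k / 2 < h x}.indicator h x ∂μ := by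
        rw [← Finset.mul_sum, integral_finsetSum]
        exact fun k _ => (hi.indicator (hm k)).const_mul _
    _ ≤ 2 * 5 ^ finrank ℝ E * ∫ x, 4 * h x ^ 2 ∂μ := by
        refine mul_le_mul_of_nonneg_left ?_ (by positivity)
        refine integral_mono (integrable_finsetSum _ fun k _ =>
          (hi.indicator (hm k)).const_mul _) (hi2.const_mul _) fun x => ?_
        have := (dyadic_sum hl (h0 x) T).trans (min_le_right _ _)
        have h2 := mul_le_mul_of_nonneg_right this (h0 x)
        rw [Finset.sum_mul] at h2
        refine le_trans (le_of_eq (Finset.sum_congr rfl fun k _ => ?_)) (h2.trans (by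
          simp only [pow_two]; linarith))
        simp only [Set.indicator, Set.mem_ofPred_eq]
        split_ifs <;> ring
    _ = _ := by rw [integral_const_mul]; ring

theorem start_bound {A B : ℝ≥0} {φ ψ : E → ℝ} (hφ : LipschitzWith A φ)
    (hψ : LipschitzWith B ψ) {S : Set E} (hS : MeasurableSet S) (hfin : μ S ≠ ∞)
    (hφ0 : ∀ x, x ∉ S → φ x = 0) {v w : E} (hv : ‖v‖ ≤ 1)
    (hw : ‖w‖ ≤ 1) {b : E → ℝ} {N : ℝ} (hN : ∀ x, |b x| ≤ N) :
    |∫ x, b x * jac v w φ ψ x ∂μ| ≤ N * (2 * A * B) * μ.real S := by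
  have hN0 : 0 ≤ N := (abs_nonneg _).trans (hN 0)
  have e : ∫ x, b x * jac v w φ ψ x ∂μ = ∫ x in S, b x * jac v w φ ψ x ∂μ := by
    rw [← integral_indicator hS]
    refine integral_congr_ae ?_
    filter_upwards [ae_lineDeriv_eq_zero μ hφ v, ae_lineDeriv_eq_zero μ hφ w] with x h1 h2
    by_cases hx : x ∈ S
    · simp [hx]
    · simp [hx, jac, h1 (hφ0 x hx), h2 (hφ0 x hx)]
  rw [e, ← Real.norm_eq_abs]
  refine norm_setIntegral_le_of_norm_le_const (lt_top_iff_ne_top.2 hfin) fun x _ => ?_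
  have key : ∀ {K : ℝ≥0} {k : E → ℝ} {u : E}, LipschitzWith K k → ‖u‖ ≤ 1 →
      |lineDeriv ℝ k x u| ≤ K := fun {K k u} hk hu => by
    have := norm_lineDeriv_le_of_lipschitz ℝ (x₀ := x) (v := u) hk
    rw [Real.norm_eq_abs] at this
    exact this.trans (mul_le_of_le_one_right K.2 hu)
  rw [norm_mul, Real.norm_eq_abs, Real.norm_eq_abs]
  refine mul_le_mul (hN x) ?_ (abs_nonneg _) hN0
  simp only [jac]
  refine (abs_sub _ _).trans ?_
  rw [abs_mul, abs_mul]
  have h1 := mul_le_mul (key hφ hv) (key hψ hw) (abs_nonneg _) A.2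
  have h2 := mul_le_mul (key hφ hw) (key hψ hv) (abs_nonneg _) A.2
  linarith

/-- Constant in `lip_pair`. -/
noncomputable def cLip (D : ℕ) : ℝ := 2 * ((1 + 4 * 8 ^ D) * 20 ^ D) + 10 * (2 * 8 ^ D * (2 + 8 * 8 ^ D))

theorem cLip_pos (D : ℕ) : 0 < cLip D := by unfold cLip; positivity

theorem bdd_pair [Nontrivial E] {f g : E → ℝ} (hf : ContDiff ℝ 1 f) (hfc : HasCompactSupport f)
    (hg : ContDiff ℝ 1 g) (hgc : HasCompactSupport g) {v w : E} (hv : ‖v‖ ≤ 1)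
    (hw : ‖w‖ ≤ 1) {b : E → ℝ} (hbl : LocallyIntegrable b μ) {M N : ℝ} (hM : Osc μ b M)
    (hN : ∀ x, |b x| ≤ N) :
    |∫ x, b x * jac v w f g x ∂μ| ≤
      9 * cLip (finrank ℝ E) * (2 ^ (finrank ℝ E + 1)) ^ 2 * (8 * 5 ^ finrank ℝ E) * M *
        ∫ x, (‖fderiv ℝ f x‖ + ‖fderiv ℝ g x‖) ^ 2 ∂μ := by
  set D := finrank ℝ E with hD
  set h : E → ℝ := fun x => ‖fderiv ℝ f x‖ + ‖fderiv ℝ g x‖ with hh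
  have hfd := hf.continuous_fderiv (by norm_num)
  have hgd := hg.continuous_fderiv (by norm_num)
  have hc : Continuous h := by fun_prop
  have hs : HasCompactSupport h := ((hfc.fderiv ℝ).norm).add ((hgc.fderiv ℝ).norm)
  have h0 : ∀ x, 0 ≤ h x := fun x => by positivity
  have hfh : ∀ x, ‖fderiv ℝ f x‖ ≤ h x := fun x => le_add_of_nonneg_right (norm_nonneg _)
  have hgh : ∀ x, ‖fderiv ℝ g x‖ ≤ h x := fun x => le_add_of_nonneg_left (norm_nonneg _)
  have hM0 := osc_nonneg μ hM
  have hN0 : 0 ≤ N := (abs_nonneg _).trans (hN 0)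
  have hbm := hbl.aestronglyMeasurable
  obtain ⟨H, hH⟩ := hc.bddAbove_range_of_hasCompactSupport hs
  have hH' : ∀ x, h x ≤ H := fun x => hH ⟨x, rfl⟩
  set L : ℝ≥0 := 2 ^ (D + 1) with hL
  set J : (E → ℝ) → (E → ℝ) → ℝ := fun φ ψ => ∫ x, b x * jac v w φ ψ x ∂μ with hJ
  have hLe : (L : ℝ) = 2 ^ (D + 1) := by rw [hL]; push_cast; rfl
  have main : ∀ l : ℝ≥0, 0 < l → |J f g| ≤
      9 * cLip D * (L : ℝ) ^ 2 * (8 * 5 ^ D) * M * ∫ x, h x ^ 2 ∂μ +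
        N * (2 * L * L) * (2 * 5 ^ D * (∫ x, h x ∂μ) * l + l ^ 2 * μ.real (tsupport f)) := by
    intro l hl
    have hlp : ∀ k : ℕ, 0 < l * 2 ^ k := fun k => by positivity
    choose F hF hFe using fun k : ℕ => lip_trunc μ hf hc hfh (l * 2 ^ k)
    choose G hG hGe using fun k : ℕ => lip_trunc μ hg hc hgh (l * 2 ^ k)
    have hbd : ∀ k : ℕ, Bornology.IsBounded (Om μ h ((l * 2 ^ k : ℝ≥0) : ℝ)) := fun k =>
      om_bounded μ hc hs h0 (by exact_mod_cast hlp k)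
    have hcs : ∀ {u k : E → ℝ} {S : Set E}, HasCompactSupport u → Bornology.IsBounded S →
        (∀ x, x ∉ S → k x = u x) → HasCompactSupport k := by
      intro u k S hu hS hk
      refine HasCompactSupport.of_support_subset_isCompact
        (K := closure (S ∪ tsupport u)) ((hS.union hu.isBounded).isCompact_closure) ?_
      intro x hx
      apply subset_closure
      by_contra hcon
      rw [Set.mem_union, not_or] at hcon
      exact hx ((hk x hcon.1).trans (image_eq_zero_of_notMem_tsupport hcon.2))
    have hFc : ∀ k, HasCompactSupport (F k) := fun k => hcs hfc (hbd k) (hFe k)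
    have hGc : ∀ k, HasCompactSupport (G k) := fun k => hcs hgc (hbd k) (hGe k)
    have hstep : ∀ k : ℕ, |J (F (k+1)) (G (k+1)) - J (F k) (G k)| ≤
        9 * cLip D * (L : ℝ) ^ 2 * M * ((l * 2 ^ k : ℝ) ^ 2 * μ.real (Om μ h (l * 2 ^ k))) := by
      intro k
      have e1 := pair_sub μ (hF (k+1)) (hF k) (hG (k+1)) (hGc (k+1)) v w hbm hN
      have e2 := pair_sub μ (hG (k+1)) (hG k) (hF k) (hFc k) v w hbm hN
      have e3 := pair_antisymm μ v w (F k) (G (k+1)) b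
      have e4 := pair_antisymm μ v w (F k) (G k) b
      have eO : ((l * 2 ^ k : ℝ≥0) : ℝ) = (l : ℝ) * 2 ^ k := by push_cast; rfl
      have eO1 : ((l * 2 ^ (k+1) : ℝ≥0) : ℝ) = (l : ℝ) * 2 ^ (k+1) := by push_cast; rfl
      have hanti : Om μ h ((l : ℝ) * 2 ^ (k+1)) ⊆ Om μ h ((l : ℝ) * 2 ^ k) := by
        apply om_anti
        have : 0 < (l:ℝ) * 2 ^ k := by positivity
        rw [pow_succ]; linarith
      have hb := hbd k
      have hFe0 := hFe k
      have hFe1 := hFe (k+1)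
      have hGe0 := hGe k
      have hGe1 := hGe (k+1)
      rw [eO] at hb hFe0 hGe0
      rw [eO1] at hFe1 hGe1
      have p1 := lip_pair μ (om_open μ h _) hb ((hF (k+1)).sub (hF k)) (hG (k+1))
        (fun x hx => by rw [hFe0 x hx, hFe1 x (fun hx' => hx (hanti hx')), sub_self])
        (hGc (k+1)) hv hw hbl hM hN
      have p2 := lip_pair μ (om_open μ h _) hb ((hG (k+1)).sub (hG k)) (hF k)
        (fun x hx => by rw [hGe0 x hx, hGe1 x (fun hx' => hx (hanti hx')), sub_self])
        (hFc k) hv hw hbl hM hN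
      change _ ≤ cLip D * _ * _ * _ * _ at p1
      change _ ≤ cLip D * _ * _ * _ * _ at p2
      have e : J (F (k+1)) (G (k+1)) - J (F k) (G k) =
          ∫ x, b x * jac v w (fun y => F (k+1) y - F k y) (G (k+1)) x ∂μ -
          ∫ x, b x * jac v w (fun y => G (k+1) y - G k y) (F k) x ∂μ := by
        simp only [hJ]; linarith
      rw [e]
      refine (abs_sub _ _).trans ((add_le_add p1 p2).trans (le_of_eq ?_))
      push_cast
      rw [hLe, hD]
      ring
    have htel : ∀ T : ℕ, |J (F T) (G T)| ≤ |J (F 0) (G 0)| + ∑ k ∈ Finset.range T,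
        9 * cLip D * (L : ℝ) ^ 2 * M * ((l * 2 ^ k : ℝ) ^ 2 * μ.real (Om μ h (l * 2 ^ k))) := by
      intro T
      induction T with
      | zero => simp
      | succ T ih =>
        rw [Finset.sum_range_succ]
        have := abs_sub_abs_le_abs_sub (J (F (T+1)) (G (T+1))) (J (F T) (G T))
        have := hstep T
        linarith
    have hstart : |J (F 0) (G 0)| ≤
        N * (2 * L * L) * (2 * 5 ^ D * (∫ x, h x ∂μ) * l + l ^ 2 * μ.real (tsupport f)) := by
      have hlr : (0:ℝ) < l := hl
      have eO : ((l * 2 ^ 0 : ℝ≥0) : ℝ) = (l : ℝ) := by push_cast; ring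
      have hb := hbd 0
      have hFe0 := hFe 0
      rw [eO] at hb hFe0
      have hfin1 : μ (Om μ h l) ≠ ∞ := hb.measure_lt_top.ne
      have hfin2 : μ (tsupport f) ≠ ∞ := hfc.measure_lt_top.ne
      have hfin : μ (Om μ h l ∪ tsupport f) ≠ ∞ := measure_union_ne_top hfin1 hfin2
      have := start_bound μ (hF 0) (hG 0) (S := Om μ h l ∪ tsupport f)
        ((om_open μ h l).measurableSet.union (isClosed_tsupport f).measurableSet) hfin
        (fun x hx => by
          rw [Set.mem_union, not_or] at hx
          exact (hFe0 x hx.1).trans (image_eq_zero_of_notMem_tsupport hx.2)) hv hw hN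
      refine this.trans ?_
      have hu := measureReal_union_le (μ := μ) (Om μ h l) (tsupport f)
      have hwk := om_weak μ hc hs h0 hlr
      have hii : ∫ x in {x | (l:ℝ) / 2 < h x}, h x ∂μ ≤ ∫ x, h x ∂μ :=
        setIntegral_le_integral (hc.integrable_of_hasCompactSupport hs)
          (Filter.Eventually.of_forall h0)
      have h3 : (l:ℝ) ^ 2 * μ.real (Om μ h l ∪ tsupport f) ≤
          2 * 5 ^ D * (∫ x, h x ∂μ) * l + l ^ 2 * μ.real (tsupport f) := by
        calc _ ≤ (l:ℝ) ^ 2 * (5 ^ D * (2 / l) * (∫ x, h x ∂μ) + μ.real (tsupport f)) := by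
              refine mul_le_mul_of_nonneg_left (hu.trans (add_le_add_left (hwk.trans ?_) _))
                (by positivity)
              exact mul_le_mul_of_nonneg_left hii (by positivity)
          _ = _ := by field_simp
      calc _ = N * (2 * L * L) * ((l:ℝ) ^ 2 * μ.real (Om μ h l ∪ tsupport f)) := by
            push_cast; rw [hLe, hD]; ring
        _ ≤ _ := mul_le_mul_of_nonneg_left h3 (by positivity)
    obtain ⟨T, hT⟩ : ∃ T : ℕ, H ≤ l * 2 ^ T := by
      obtain ⟨T, hT⟩ := pow_unbounded_of_one_lt (H / l) (one_lt_two)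
      refine ⟨T, ?_⟩
      have hlr : (0:ℝ) < l := hl
      rw [div_lt_iff₀ hlr] at hT
      linarith
    have hem : Om μ h ((l * 2 ^ T : ℝ≥0) : ℝ) = ∅ := by
      apply om_empty μ hc hs
      intro x
      push_cast
      exact (hH' x).trans hT
    have eF : F T = f := funext fun x => hFe T x (by rw [hem]; exact Set.notMem_empty x)
    have eG : G T = g := funext fun x => hGe T x (by rw [hem]; exact Set.notMem_empty x)
    have ht := htel T
    rw [eF, eG, ← Finset.mul_sum] at ht
    have hsum := om_sum μ hc hs h0 (l := l) hl T
    have hcl := cLip_pos D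
    have := mul_le_mul_of_nonneg_left hsum
      (show 0 ≤ 9 * cLip D * (L : ℝ) ^ 2 * M by positivity)
    linarith
  have hlim : Filter.Tendsto (fun l : ℝ => 9 * cLip D * (L : ℝ) ^ 2 * (8 * 5 ^ D) * M *
        ∫ x, h x ^ 2 ∂μ +
        N * (2 * L * L) * (2 * 5 ^ D * (∫ x, h x ∂μ) * l + l ^ 2 * μ.real (tsupport f)))
      (𝓝[>] 0) (𝓝 (9 * cLip D * (L : ℝ) ^ 2 * (8 * 5 ^ D) * M * ∫ x, h x ^ 2 ∂μ)) := by
    refine tendsto_nhdsWithin_of_tendsto_nhds ?_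
    have : Continuous (fun l : ℝ => 9 * cLip D * (L : ℝ) ^ 2 * (8 * 5 ^ D) * M *
        ∫ x, h x ^ 2 ∂μ +
        N * (2 * L * L) * (2 * 5 ^ D * (∫ x, h x ∂μ) * l + l ^ 2 * μ.real (tsupport f))) := by
      fun_prop
    simpa using this.tendsto 0
  rw [← hLe]
  refine ge_of_tendsto hlim ?_
  filter_upwards [self_mem_nhdsWithin] with l hl
  exact main ⟨l, le_of_lt hl⟩ hl
end P6

section P7
set_option linter.unusedSectionVars false
open Module
variable {E : Type*} [NormedAddCommGroup E] [NormedSpace ℝ E] [FiniteDimensional ℝ E]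
  [MeasurableSpace E] [BorelSpace E] (μ : Measure E) [μ.IsAddHaarMeasure]

/-- The constant of the pairing estimate. -/
noncomputable def cFin (D : ℕ) : ℝ := 9 * cLip D * (2 ^ (D + 1)) ^ 2 * (8 * 5 ^ D)

theorem cFin_pos (D : ℕ) : 0 < cFin D := by
  have := cLip_pos D
  unfold cFin; positivity

/-- Truncation to `[-N, N]`. -/
noncomputable def clamp (N t : ℝ) : ℝ := max (-N) (min N t)

theorem clamp_abs {N : ℝ} (hN : 0 ≤ N) (t : ℝ) : |clamp N t| ≤ N := by
  unfold clamp
  rw [abs_le]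
  exact ⟨le_max_left _ _, max_le (by linarith) (min_le_left _ _)⟩

theorem clamp_lip (N s t : ℝ) : |clamp N s - clamp N t| ≤ |s - t| := by
  unfold clamp
  have h1 := abs_max_sub_max_le_max (-N) (min N s) (-N) (min N t)
  have h2 := abs_min_sub_min_le_max N s N t
  simp only [sub_self, abs_zero] at h1 h2
  rw [max_eq_right (abs_nonneg (min N s - min N t))] at h1
  rw [max_eq_right (abs_nonneg (s - t))] at h2
  exact h1.trans h2

theorem clamp_eq {N t : ℝ} (h : |t| ≤ N) : clamp N t = t := by
  rw [abs_le] at h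
  unfold clamp
  rw [min_eq_right h.2, max_eq_right h.1]

theorem clamp_abs_le {N : ℝ} (hN : 0 ≤ N) (t : ℝ) : |clamp N t| ≤ |t| := by
  have := clamp_lip N t 0
  rwa [clamp_eq (t := 0) (by simpa using hN), sub_zero, sub_zero] at this

theorem clamp_cont (N : ℝ) : Continuous (clamp N) := by
  unfold clamp; fun_prop

theorem clamp_locInt {b : E → ℝ} (hbl : LocallyIntegrable b μ) {N : ℝ} (hN : 0 ≤ N) :
    LocallyIntegrable (fun x => clamp N (b x)) μ := by
  refine hbl.mono ((clamp_cont N).comp_aestronglyMeasurable hbl.aestronglyMeasurable) ?_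
  exact Filter.Eventually.of_forall fun x => clamp_abs_le hN (b x)

theorem locInt_ball {b : E → ℝ} (hbl : LocallyIntegrable b μ) (x : E) (r : ℝ) :
    IntegrableOn b (ball x r) μ :=
  (hbl.integrableOn_isCompact (isCompact_closedBall x r)).mono_set ball_subset_closedBall

theorem clamp_osc {b : E → ℝ} (hbl : LocallyIntegrable b μ) {N M : ℝ} (hN : 0 ≤ N)
    (hM : Osc μ b M) : Osc μ (fun x => clamp N (b x)) M := by
  intro x ρ hρ
  obtain ⟨c, hc⟩ := hM x ρ hρ
  refine ⟨clamp N c, le_trans ?_ hc⟩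
  have hcI : ∀ c : ℝ, Integrable (fun _ : E => c) (μ.restrict (ball x ρ)) := fun c =>
    integrableOn_const (by exact measure_ball_lt_top.ne)
  refine integral_mono ?_ ?_ fun y => clamp_lip N (b y) c
  · exact ((locInt_ball μ (clamp_locInt μ hbl hN) x ρ).sub (hcI _)).abs
  · exact ((locInt_ball μ hbl x ρ).sub (hcI _)).abs

theorem jac_fderiv {f g : E → ℝ} (hf : ContDiff ℝ 1 f) (hg : ContDiff ℝ 1 g) (v w x : E) :
    jac v w f g x = fderiv ℝ f x v * fderiv ℝ g x w - fderiv ℝ f x w * fderiv ℝ g x v := by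
  have h1 := hf.differentiable (by norm_num) x
  have h2 := hg.differentiable (by norm_num) x
  simp only [jac, h1.lineDeriv_eq_fderiv, h2.lineDeriv_eq_fderiv]

theorem integrable_b_jac {f g : E → ℝ} (hf : ContDiff ℝ 1 f) (hfc : HasCompactSupport f)
    (hg : ContDiff ℝ 1 g) (v w : E) {b : E → ℝ} (hbl : LocallyIntegrable b μ) :
    Integrable (fun x => b x * jac v w f g x) μ := by
  have hfd := hf.continuous_fderiv (by norm_num)
  have hgd := hg.continuous_fderiv (by norm_num)
  have e : jac v w f g = fun x => fderiv ℝ f x v * fderiv ℝ g x w - fderiv ℝ f x w * fderiv ℝ g x v :=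
    funext fun x => jac_fderiv hf hg v w x
  have hcj : Continuous (jac v w f g) := by rw [e]; fun_prop
  have hsj : HasCompactSupport (jac v w f g) := by
    refine (hfc.fderiv ℝ).mono fun x hx => ?_
    rw [Function.mem_support] at hx ⊢
    intro hz
    apply hx
    rw [e]
    simp [hz]
  have := hbl.integrable_smul_left_of_hasCompactSupport hcj hsj
  refine this.congr (Filter.Eventually.of_forall fun x => ?_)
  simp [mul_comm]

theorem unb_pair [Nontrivial E] {f g : E → ℝ} (hf : ContDiff ℝ 1 f) (hfc : HasCompactSupport f)
    (hg : ContDiff ℝ 1 g) (hgc : HasCompactSupport g) {v w : E} (hv : ‖v‖ ≤ 1)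
    (hw : ‖w‖ ≤ 1) {b : E → ℝ} (hbl : LocallyIntegrable b μ) {M : ℝ} (hM : Osc μ b M) :
    |∫ x, b x * jac v w f g x ∂μ| ≤
      cFin (finrank ℝ E) * M * ∫ x, (‖fderiv ℝ f x‖ + ‖fderiv ℝ g x‖) ^ 2 ∂μ := by
  have hIntg := integrable_b_jac μ hf hfc hg v w hbl
  have hlim : Filter.Tendsto (fun n : ℕ => ∫ x, clamp n (b x) * jac v w f g x ∂μ) Filter.atTop
      (𝓝 (∫ x, b x * jac v w f g x ∂μ)) := by
    refine tendsto_integral_of_dominated_convergence (fun x => |b x * jac v w f g x|)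
      (fun n => (integrable_b_jac μ hf hfc hg v w
        (clamp_locInt μ hbl n.cast_nonneg)).aestronglyMeasurable) hIntg.abs ?_ ?_
    · intro n
      refine Filter.Eventually.of_forall fun x => ?_
      rw [Real.norm_eq_abs, abs_mul, abs_mul]
      exact mul_le_mul_of_nonneg_right (clamp_abs_le n.cast_nonneg _) (abs_nonneg _)
    · refine Filter.Eventually.of_forall fun x => ?_
      refine tendsto_const_nhds.congr' ?_
      filter_upwards [Filter.eventually_ge_atTop ⌈|b x|⌉₊] with n hn
      rw [clamp_eq (Nat.ceil_le.1 hn)]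
  refine le_of_tendsto' hlim.abs fun n => ?_
  exact bdd_pair μ hf hfc hg hgc hv hw (clamp_locInt μ hbl n.cast_nonneg)
    (clamp_osc μ hbl n.cast_nonneg hM) (fun x => clamp_abs n.cast_nonneg _)

theorem opt_scale {X P a c : ℝ} (hP : 0 ≤ P) (ha : 0 ≤ a) (hc : 0 ≤ c)
    (h : ∀ s : ℝ, 0 < s → X ≤ P * (s ^ 2 * a ^ 2 + (s⁻¹) ^ 2 * c ^ 2)) : X ≤ 2 * P * (a * c) := by
  have key : ∀ ε : ℝ, ε ∈ Set.Ioi (0:ℝ) → X ≤ P * (2 * (a * c) + ε * (a + c)) := by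
    intro ε hε
    have hε : 0 < ε := hε
    have hs : 0 < (c + ε) / (a + ε) := by positivity
    refine (h (Real.sqrt ((c + ε) / (a + ε))) (Real.sqrt_pos.2 hs)).trans ?_
    refine mul_le_mul_of_nonneg_left ?_ hP
    rw [inv_pow, Real.sq_sqrt hs.le, inv_div]
    have h1 : (c + ε) / (a + ε) * a ^ 2 ≤ (c + ε) * a := by
      rw [div_mul_eq_mul_div, div_le_iff₀ (by positivity)]
      nlinarith [mul_nonneg (mul_nonneg (add_nonneg hc hε.le) ha) hε.le]
    have h2 : (a + ε) / (c + ε) * c ^ 2 ≤ (a + ε) * c := by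
      rw [div_mul_eq_mul_div, div_le_iff₀ (by positivity)]
      nlinarith [mul_nonneg (mul_nonneg (add_nonneg ha hε.le) hc) hε.le]
    linarith
  have hlim : Filter.Tendsto (fun ε : ℝ => P * (2 * (a * c) + ε * (a + c))) (𝓝[>] 0)
      (𝓝 (2 * P * (a * c))) := by
    refine tendsto_nhdsWithin_of_tendsto_nhds ?_
    have : Continuous (fun ε : ℝ => P * (2 * (a * c) + ε * (a + c))) := by fun_prop
    have := this.tendsto 0
    simp only [zero_mul, add_zero] at this
    convert this using 2
    ring
  refine ge_of_tendsto hlim ?_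
  filter_upwards [self_mem_nhdsWithin] with ε hε using key ε hε

theorem int_sq {f : E → ℝ} (hf : ContDiff ℝ 1 f) (hfc : HasCompactSupport f) :
    Integrable (fun x => ‖fderiv ℝ f x‖ ^ 2) μ := by
  have hfd := hf.continuous_fderiv (by norm_num)
  refine Continuous.integrable_of_hasCompactSupport (by fun_prop) ?_
  refine (hfc.fderiv ℝ).mono fun x hx => ?_
  rw [Function.mem_support] at hx ⊢
  intro hz
  rw [hz] at hx
  simp at hx

theorem final_pair [Nontrivial E] {f g : E → ℝ} (hf : ContDiff ℝ 1 f) (hfc : HasCompactSupport f)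
    (hg : ContDiff ℝ 1 g) (hgc : HasCompactSupport g) {v w : E} (hv : ‖v‖ ≤ 1)
    (hw : ‖w‖ ≤ 1) {b : E → ℝ} (hbl : LocallyIntegrable b μ) {M : ℝ} (hM : Osc μ b M) :
    |∫ x, b x * jac v w f g x ∂μ| ≤
      4 * cFin (finrank ℝ E) * M * (Real.sqrt (∫ x, ‖fderiv ℝ f x‖ ^ 2 ∂μ) *
        Real.sqrt (∫ x, ‖fderiv ℝ g x‖ ^ 2 ∂μ)) := by
  have hM0 := osc_nonneg μ hM
  have hK := cFin_pos (finrank ℝ E)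
  have := opt_scale (X := |∫ x, b x * jac v w f g x ∂μ|) (P := 2 * cFin (finrank ℝ E) * M)
    (a := Real.sqrt (∫ x, ‖fderiv ℝ f x‖ ^ 2 ∂μ)) (c := Real.sqrt (∫ x, ‖fderiv ℝ g x‖ ^ 2 ∂μ))
    (by positivity) (Real.sqrt_nonneg _) (Real.sqrt_nonneg _) ?_
  · linarith
  intro s hs
  rw [Real.sq_sqrt (integral_nonneg fun x => by positivity),
    Real.sq_sqrt (integral_nonneg fun x => by positivity)]
  have hfs : ContDiff ℝ 1 (fun x => s * f x) := contDiff_const.mul hf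
  have hgs : ContDiff ℝ 1 (fun x => s⁻¹ * g x) := contDiff_const.mul hg
  have hfsc : HasCompactSupport (fun x => s * f x) := hfc.mul_left (f := fun _ => s)
  have hgsc : HasCompactSupport (fun x => s⁻¹ * g x) := hgc.mul_left (f := fun _ => s⁻¹)
  have h1 := unb_pair μ hfs hfsc hgs hgsc hv hw hbl hM
  have df : ∀ x, fderiv ℝ (fun x => s * f x) x = s • fderiv ℝ f x := fun x =>
    fderiv_const_mul (hf.differentiable (by norm_num) x) s
  have dg : ∀ x, fderiv ℝ (fun x => s⁻¹ * g x) x = s⁻¹ • fderiv ℝ g x := fun x =>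
    fderiv_const_mul (hg.differentiable (by norm_num) x) s⁻¹
  have e : ∀ x, jac v w (fun x => s * f x) (fun x => s⁻¹ * g x) x = jac v w f g x := by
    intro x
    rw [jac_fderiv hfs hgs, jac_fderiv hf hg, df, dg]
    simp only [smul_apply, smul_eq_mul]
    field_simp
  simp only [e] at h1
  refine h1.trans ?_
  rw [mul_assoc 2, mul_assoc 2, mul_comm 2, mul_assoc _ _ 2, mul_comm _ 2]
  refine mul_le_mul_of_nonneg_left ?_ (by positivity)
  have i1 := (int_sq μ hf hfc).const_mul (s ^ 2)
  have i2 := (int_sq μ hg hgc).const_mul (s⁻¹ ^ 2)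
  rw [← integral_const_mul, ← integral_const_mul, ← integral_add i1 i2, ← integral_const_mul]
  refine integral_mono_of_nonneg (Filter.Eventually.of_forall fun x => by positivity)
    ((i1.add i2).const_mul 2) (Filter.Eventually.of_forall fun x => ?_)
  simp only [df, dg, norm_smul, Real.norm_of_nonneg hs.le, Real.norm_of_nonneg (inv_pos.2 hs).le]
  nlinarith [sq_nonneg (s * ‖fderiv ℝ f x‖ - s⁻¹ * ‖fderiv ℝ g x‖)]
end P7

section P8
open Module

theorem osc_of_bmo {n : ℕ} {f : EuclideanSpace ℝ (Fin n) → ℝ} {M : ℝ} (h : IsBMOBound f M) :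
    Osc volume f M := by
  intro x ρ hρ
  refine ⟨⨍ z in ball x ρ, f z, ?_⟩
  have h1 := h x ρ hρ
  have hV := real_ball_pos volume x hρ
  generalize ⨍ z in ball x ρ, f z = c at h1 ⊢
  rw [setAverage_eq, smul_eq_mul, inv_mul_le_iff₀ hV] at h1
  linarith

theorem osc_mono {n : ℕ} {f : EuclideanSpace ℝ (Fin n) → ℝ} {M M' : ℝ} (h : Osc volume f M)
    (hM : M ≤ M') : Osc volume f M' := by
  intro x ρ hρ
  obtain ⟨c, hc⟩ := h x ρ hρ
  exact ⟨c, hc.trans (mul_le_mul_of_nonneg_right hM measureReal_nonneg)⟩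

theorem osc_neg {n : ℕ} {f g : EuclideanSpace ℝ (Fin n) → ℝ} {M : ℝ} (h : Osc volume f M)
    (hg : ∀ x, g x = - f x) : Osc volume g M := by
  intro x ρ hρ
  obtain ⟨c, hc⟩ := h x ρ hρ
  refine ⟨-c, le_trans (le_of_eq ?_) hc⟩
  congr 1
  ext y
  rw [hg, ← abs_neg]
  congr 1
  ring

theorem toReal_eLpNorm_two {n : ℕ} {f : EuclideanSpace ℝ (Fin n) → ℝ} (hf : ContDiff ℝ 1 f)
    (hfc : HasCompactSupport f) :
    (eLpNorm (fun x => ‖fderiv ℝ f x‖) 2 volume).toReal =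
      Real.sqrt (∫ x, ‖fderiv ℝ f x‖ ^ 2) := by
  have hfd := hf.continuous_fderiv (by norm_num)
  have hm : MemLp (fun x => ‖fderiv ℝ f x‖) 2 volume :=
    (by fun_prop : Continuous fun x => ‖fderiv ℝ f x‖).memLp_of_hasCompactSupport
      (hfc.fderiv ℝ).norm
  rw [hm.eLpNorm_eq_integral_rpow_norm (by norm_num) (by norm_num), ENNReal.toReal_ofReal
    (by positivity), Real.sqrt_eq_rpow]
  norm_num

theorem main_thm (n : ℕ) :
    ∃ C > (0 : ℝ), ∀ (b : Fin n → Fin n → EuclideanSpace ℝ (Fin n) → ℝ)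
      (M : Fin n → Fin n → ℝ),
      (∀ i j, LocallyIntegrable (b i j) volume) →
      (∀ i j x, b i j x = -(b j i x)) →
      (∀ i j, IsBMOBound (b i j) (M i j)) →
      ∀ f g : EuclideanSpace ℝ (Fin n) → ℝ,
        ContDiff ℝ 1 f → HasCompactSupport f →
        ContDiff ℝ 1 g → HasCompactSupport g →
        |∫ x, ∑ i, ∑ j,
            fderiv ℝ f x (EuclideanSpace.single i 1) * b i j x
              * fderiv ℝ g x (EuclideanSpace.single j 1)| ≤
          C * Real.sqrt (∑ i, ∑ j, if i < j then M i j ^ 2 else 0)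
            * (eLpNorm (fun x => ‖fderiv ℝ f x‖) 2 volume).toReal
            * (eLpNorm (fun x => ‖fderiv ℝ g x‖) 2 volume).toReal := by
  set K := cFin (finrank ℝ (EuclideanSpace ℝ (Fin n))) with hK
  have hKp : 0 < K := cFin_pos _
  refine ⟨2 * n ^ 2 * K + 1, by positivity, ?_⟩
  intro b M hbl hsk hbmo f g hf hfc hg hgc
  rw [toReal_eLpNorm_two hf hfc, toReal_eLpNorm_two hg hgc]
  set Q := Real.sqrt (∑ i, ∑ j, if i < j then M i j ^ 2 else 0) with hQ
  set a := Real.sqrt (∫ x, ‖fderiv ℝ f x‖ ^ 2)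
  set c := Real.sqrt (∫ x, ‖fderiv ℝ g x‖ ^ 2)
  have hQ0 : 0 ≤ Q := Real.sqrt_nonneg _
  have ha : 0 ≤ a := Real.sqrt_nonneg _
  have hc : 0 ≤ c := Real.sqrt_nonneg _
  rcases Nat.eq_zero_or_pos n with rfl | hn
  · simp only [Finset.univ_eq_empty, Finset.sum_empty, integral_zero, abs_zero]
    positivity
  haveI : Nonempty (Fin n) := ⟨⟨0, hn⟩⟩
  haveI : Nontrivial (EuclideanSpace ℝ (Fin n)) := by
    refine ⟨0, EuclideanSpace.single ⟨0, hn⟩ 1, fun h => ?_⟩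
    have := congrArg (fun z => ‖z‖) h
    simp at this
  have hMQ : ∀ i j, i < j → M i j ≤ Q := by
    intro i j hij
    apply Real.le_sqrt_of_sq_le
    have h1 : ∀ i j, 0 ≤ (if i < j then M i j ^ 2 else 0) := fun i j => by
      split_ifs <;> positivity
    have h2 := Finset.single_le_sum (f := fun j => if i < j then M i j ^ 2 else 0)
      (fun j _ => h1 i j) (Finset.mem_univ j)
    have h3 := Finset.single_le_sum (f := fun i => ∑ j, if i < j then M i j ^ 2 else 0)
      (fun i _ => Finset.sum_nonneg fun j _ => h1 i j) (Finset.mem_univ i)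
    simp only [hij, if_true] at h2
    exact h2.trans h3
  set e : Fin n → EuclideanSpace ℝ (Fin n) := fun i => EuclideanSpace.single i 1 with he
  have hen : ∀ i, ‖e i‖ ≤ 1 := fun i => by simp [he]
  have hij : ∀ i j, |∫ x, b i j x * jac (e i) (e j) f g x| ≤ 4 * K * Q * (a * c) := by
    intro i j
    rcases lt_trichotomy i j with h | h | h
    · exact final_pair volume hf hfc hg hgc (hen i) (hen j) (hbl i j)
        (osc_mono (osc_of_bmo (hbmo i j)) (hMQ i j h))
    · subst h
      have : ∀ x, b i i x * jac (e i) (e i) f g x = 0 := fun x => by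
        simp only [jac]; ring
      simp only [this, integral_zero, abs_zero]
      positivity
    · exact final_pair volume hf hfc hg hgc (hen i) (hen j) (hbl i j)
        (osc_neg (osc_mono (osc_of_bmo (hbmo j i)) (hMQ j i h)) (hsk i j))
  have hpt : ∀ x, ∑ i, ∑ j, fderiv ℝ f x (e i) * b i j x * fderiv ℝ g x (e j) =
      2⁻¹ * ∑ i, ∑ j, b i j x * jac (e i) (e j) f g x := by
    intro x
    have h1 : ∑ i, ∑ j, fderiv ℝ f x (e j) * b i j x * fderiv ℝ g x (e i) =
        - ∑ i, ∑ j, fderiv ℝ f x (e i) * b i j x * fderiv ℝ g x (e j) := by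
      rw [Finset.sum_comm, ← Finset.sum_neg_distrib]
      refine Finset.sum_congr rfl fun i _ => ?_
      rw [← Finset.sum_neg_distrib]
      refine Finset.sum_congr rfl fun j _ => ?_
      rw [hsk j i x]; ring
    have h2 : ∑ i, ∑ j, b i j x * jac (e i) (e j) f g x =
        ∑ i, ∑ j, fderiv ℝ f x (e i) * b i j x * fderiv ℝ g x (e j) -
        ∑ i, ∑ j, fderiv ℝ f x (e j) * b i j x * fderiv ℝ g x (e i) := by
      rw [← Finset.sum_sub_distrib]
      refine Finset.sum_congr rfl fun i _ => ?_
      rw [← Finset.sum_sub_distrib]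
      refine Finset.sum_congr rfl fun j _ => ?_
      rw [jac_fderiv hf hg]; ring
    rw [h2, h1]; ring
  have hIntg : ∀ i j, Integrable (fun x => b i j x * jac (e i) (e j) f g x) volume := fun i j =>
    integrable_b_jac volume hf hfc hg _ _ (hbl i j)
  have heq : ∫ x, ∑ i, ∑ j, fderiv ℝ f x (e i) * b i j x * fderiv ℝ g x (e j) =
      2⁻¹ * ∑ i, ∑ j, ∫ x, b i j x * jac (e i) (e j) f g x := by
    simp only [hpt]
    rw [integral_const_mul, integral_finsetSum _ fun i _ => integrable_finsetSum _ fun j _ => hIntg i j]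
    congr 1
    exact Finset.sum_congr rfl fun i _ => integral_finsetSum _ fun j _ => hIntg i j
  rw [heq, abs_mul]
  have hsum : |∑ i, ∑ j, ∫ x, b i j x * jac (e i) (e j) f g x| ≤
      (n:ℝ) * (n * (4 * K * Q * (a * c))) := by
    refine (Finset.abs_sum_le_sum_abs _ _).trans ?_
    refine (Finset.sum_le_card_nsmul _ _ (n * (4 * K * Q * (a * c))) fun i _ => ?_).trans
      (by simp)
    refine (Finset.abs_sum_le_sum_abs _ _).trans ?_
    exact (Finset.sum_le_card_nsmul _ _ (4 * K * Q * (a * c)) fun j _ => hij i j).trans (by simp)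
  have h2 : |(2⁻¹:ℝ)| = 2⁻¹ := by norm_num
  rw [h2]
  have : 0 ≤ Q * a * c := by positivity
  nlinarith
end P8

end Aux

/-- For a skew-symmetric matrix `b` of BMO functions,
`|∫ ⟨∇f, b·∇g⟩| ≤ C ‖b‖_BMO ‖∇f‖₂ ‖∇g‖₂`, with `C = C(n)` and
`‖b‖_BMO² = ∑_{i<j} ‖bⁱʲ‖_BMO²`. -/
theorem skew_bmo_bilinear_bound (n : ℕ) :
    ∃ C > (0 : ℝ), ∀ (b : Fin n → Fin n → EuclideanSpace ℝ (Fin n) → ℝ)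
      (M : Fin n → Fin n → ℝ),
      (∀ i j, LocallyIntegrable (b i j) volume) →
      (∀ i j x, b i j x = -(b j i x)) →
      (∀ i j, IsBMOBound (b i j) (M i j)) →
      ∀ f g : EuclideanSpace ℝ (Fin n) → ℝ,
        ContDiff ℝ 1 f → HasCompactSupport f →
        ContDiff ℝ 1 g → HasCompactSupport g →
        |∫ x, ∑ i, ∑ j,
            fderiv ℝ f x (EuclideanSpace.single i 1) * b i j x
              * fderiv ℝ g x (EuclideanSpace.single j 1)| ≤
          C * Real.sqrt (∑ i, ∑ j, if i < j then M i j ^ 2 else 0)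
            * (eLpNorm (fun x => ‖fderiv ℝ f x‖) 2 volume).toReal
            * (eLpNorm (fun x => ‖fderiv ℝ g x‖) 2 volume).toReal := main_thm n
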